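/- arXiv:1711.07152 — 7 statements merged into one kernel-verified Lean document; each statement's English description precedes it below -/
import Mathlib

section
/- Extend m by setting m_n = n, and define the bounce sequence by b_0 = 0 and b_{k+1} = m_{b_k + 1}; since m_i ≥ i this sequence is strictly increasing until it reaches n, and the bounce number r of P(m) is the least k with b_k = n. Then every chain of the poset P(m) (every subset of {1,…,n} totally ordered by <_P) has at most r elements. -/
/-- The strict order relation of the natural unit interval order `P(m)` on `{1,…,n}`:
`i <_P j` iff `i ≤ n - 1` and `j > m i`. -/
def ltP (n : ℕ) (m : ℕ → ℕ) (i j : ℕ) : Prop := i ≤ n - 1 ∧ m i < j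

/-- Extend `m` by `m n = n` and define the bounce sequence by
`b 0 = 0`, `b (k+1) = m (b k + 1)`; let `r` be the least `k` with `b k = n`
(the bounce number). Then every chain of `P(m)` has at most `r` elements. -/
theorem stmt_1 (n : ℕ) (hn : 1 ≤ n) (m : ℕ → ℕ)
    (hmono : ∀ i j, 1 ≤ i → i ≤ j → j ≤ n - 1 → m i ≤ m j)
    (hle : ∀ i, 1 ≤ i → i ≤ n - 1 → m i ≤ n)
    (hge : ∀ i, 1 ≤ i → i ≤ n - 1 → i ≤ m i)
    (hmn : m n = n)
    (b : ℕ → ℕ) (hb0 : b 0 = 0) (hbs : ∀ k, b (k + 1) = m (b k + 1))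
    (r : ℕ) (hr : b r = n) (hrmin : ∀ k, b k = n → r ≤ k)
    (C : Finset ℕ) (hC : C ⊆ Finset.Icc 1 n)
    (hchain : ∀ a ∈ C, ∀ c ∈ C, a ≠ c → ltP n m a c ∨ ltP n m c a) :
    C.card ≤ r := by
  have hlt : ∀ k, b k ≤ n → k < r → b k < n := fun k hk hkr =>
    lt_of_le_of_ne hk fun h => absurd (hrmin k h) (by omega)
  have hm : ∀ i, 1 ≤ i → i ≤ n → m i ≤ n := by
    intro i h1 h2
    rcases h2.eq_or_lt with rfl | h
    · exact hmn.le
    · exact hle i h1 (by omega)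
  have hcard : ∀ k, k ≤ r → b k ≤ n ∧ (C.filter (· ≤ b k)).card ≤ k := by
    intro k
    induction k with
    | zero =>
      refine fun _ => ⟨by omega, ?_⟩
      rw [Nat.le_zero, Finset.card_eq_zero, Finset.filter_eq_empty_iff]
      intro x hx
      have := Finset.mem_Icc.mp (hC hx)
      omega
    | succ k ih =>
      intro hk
      obtain ⟨hbn, hc⟩ := ih (by omega)
      have hbk := hlt k hbn hk
      refine ⟨hbs k ▸ hm _ (by omega) (by omega), ?_⟩
      have hnot : ∀ a c, b k < a → c ≤ b (k + 1) → ¬ ltP n m a c := by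
        rintro a c ha hcb ⟨han, hac⟩
        have := hmono (b k + 1) a (by omega) ha han
        have := hbs k
        omega
      have hone : (C.filter (fun x => b k < x ∧ x ≤ b (k + 1))).card ≤ 1 := by
        rw [Finset.card_le_one]
        intro x hx y hy
        rw [Finset.mem_filter] at hx hy
        by_contra hxy
        rcases hchain x hx.1 y hy.1 hxy with h | h
        · exact hnot x y hx.2.1 hy.2.2 h
        · exact hnot y x hy.2.1 hx.2.2 h
      have hsub : C.filter (· ≤ b (k + 1)) ⊆
          C.filter (· ≤ b k) ∪ C.filter (fun x => b k < x ∧ x ≤ b (k + 1)) := by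
        intro x hx
        simp only [Finset.mem_union, Finset.mem_filter] at hx ⊢
        have := le_or_gt x (b k)
        tauto
      have := Finset.card_le_card hsub
      have := Finset.card_union_le (C.filter (· ≤ b k))
        (C.filter (fun x => b k < x ∧ x ≤ b (k + 1)))
      omega
  have hfilter : C.filter (· ≤ b r) = C :=
    Finset.filter_true_of_mem fun x hx => hr ▸ (Finset.mem_Icc.mp (hC hx)).2
  exact hfilter ▸ (hcard r le_rfl).2
end

section
/- Let G be a simple graph on vertex set {1,…,n}, and let G̃ be the simple graph on {1,…,n} in which {i,j} is an edge if and only if {n+1−i, n+1−j} is an edge of G. For every N ≥ 1 and every proper coloring κ of G with N colors, the map κ̃ defined by κ̃(i) = κ(n+1−i) is a proper coloring of G̃, and asc_G(κ) + asc_{G̃}(κ̃) equals the number of edges of G. -/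
open scoped Classical

/-- The number of ascents of a coloring `κ` of a graph `G` on vertex set `{1,…,n}`
(`a : Fin n` represents the number `a.val + 1`): the number of edges `{i,j}` of `G`
with `i < j` and `κ i < κ j`. -/
noncomputable def ascG (n N : ℕ) (G : SimpleGraph (Fin n)) (κ : Fin n → Fin N) : ℕ :=
  ((Finset.univ : Finset (Fin n × Fin n)).filter
    (fun p => p.1 < p.2 ∧ G.Adj p.1 p.2 ∧ κ p.1 < κ p.2)).card

/-- The number of edges of a graph on `{1,…,n}`, counted as pairs `i < j`. -/
noncomputable def edgeCount (n : ℕ) (G : SimpleGraph (Fin n)) : ℕ :=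
  ((Finset.univ : Finset (Fin n × Fin n)).filter
    (fun p => p.1 < p.2 ∧ G.Adj p.1 p.2)).card

/-- Let `G` be a simple graph on `{1,…,n}` and `G'` the graph with
`{i,j}` an edge iff `{n+1-i, n+1-j}` is an edge of `G` (in `Fin n` terms: reflection by
`Fin.rev`). For every `N ≥ 1` and every proper coloring `κ` of `G` with `N` colors,
the map `κ̃ = κ ∘ rev` is a proper coloring of `G'`, and
`asc_G(κ) + asc_{G'}(κ̃)` equals the number of edges of `G`. -/
theorem stmt_3 (n N : ℕ) (hN : 1 ≤ N)
    (G G' : SimpleGraph (Fin n))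
    (hG' : ∀ a b : Fin n, G'.Adj a b ↔ G.Adj a.rev b.rev)
    (κ : Fin n → Fin N)
    (hκ : ∀ u v : Fin n, G.Adj u v → κ u ≠ κ v) :
    (∀ u v : Fin n, G'.Adj u v → κ u.rev ≠ κ v.rev) ∧
    ascG n N G κ + ascG n N G' (fun i => κ i.rev) = edgeCount n G := by
  refine ⟨fun u v h => hκ _ _ ((hG' u v).1 h), ?_⟩
  have hrev : ascG n N G' (fun i => κ i.rev) =
      ((Finset.univ : Finset (Fin n × Fin n)).filter
        (fun p => (p.1 < p.2 ∧ G.Adj p.1 p.2) ∧ ¬ κ p.1 < κ p.2)).card := by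
    unfold ascG
    refine Finset.card_nbij' (fun p => (p.2.rev, p.1.rev)) (fun p => (p.2.rev, p.1.rev))
      ?_ ?_ ?_ ?_
    · rintro ⟨a, b⟩ h
      simp only [Finset.coe_filter, Finset.mem_univ, true_and, Set.mem_ofPred_eq] at h ⊢
      exact ⟨⟨Fin.rev_lt_rev.2 h.1, ((hG' a b).1 h.2.1).symm⟩, h.2.2.not_gt⟩
    · rintro ⟨a, b⟩ h
      simp only [Finset.coe_filter, Finset.mem_univ, true_and, Set.mem_ofPred_eq] at h ⊢
      refine ⟨Fin.rev_lt_rev.2 h.1.1, (hG' _ _).2 ?_, ?_⟩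
      · simpa using h.1.2.symm
      · simpa using lt_of_le_of_ne (not_lt.1 h.2) (hκ _ _ h.1.2).symm
    · intro p _
      simp
    · intro p _
      simp
  rw [hrev]
  unfold ascG edgeCount
  conv_rhs =>
    rw [← Finset.card_filter_add_card_filter_not (fun p : Fin n × Fin n => κ p.1 < κ p.2),
      Finset.filter_filter, Finset.filter_filter]
  simp only [and_assoc]
end

section
/- Let P = P(m) be a natural unit interval order on {1,…,n} with m_1 = r, where 1 ≤ r ≤ n−2 and m_i = n for all r+1 ≤ i ≤ n−1, and let G = inc(P). Fix ℓ ≥ 0 with 2ℓ + 2 ≤ n, and let T'_ℓ be the set of P-tableaux T = [a_{i,j}] of shape (2^ℓ, 1^{n−2ℓ}) (ℓ rows of length 2 followed by n−2ℓ rows of length 1, so n−ℓ rows in total) for which there exists s with ℓ+2 ≤ s ≤ n−ℓ such that a_{i,1} <_P a_{s,1} for every i with ℓ+1 ≤ i ≤ s−1. Then Σ_T t^{inv_G(T)}, summed over all P-tableaux T of shape (2^{ℓ+1}, 1^{n−2ℓ−2}), equals Σ_{T ∈ T'_ℓ} t^{inv_G(T)} as polynomials in ℤ[t]. -/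
open scoped Classical

/-- A `P(m)`-tableau of shape `lam` (a list of row lengths, rows indexed from the top,
cells 0-based), encoded by the position function `pos` sending the value `x + 1`
(for `x : Fin n`) to its cell `(row, column)`. -/
def IsPTab (n : ℕ) (m : ℕ → ℕ) (lam : List ℕ) (pos : Fin n → Fin n × Fin n) : Prop :=
  Function.Injective pos ∧
  (∀ c : Fin n × Fin n,
    (∃ x, pos x = c) ↔ c.1.val < lam.length ∧ c.2.val < lam.getD c.1.val 0) ∧
  (∀ x y : Fin n, (pos y).1 = (pos x).1 → (pos y).2.val = (pos x).2.val + 1 →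
    ltP n m (x.val + 1) (y.val + 1)) ∧
  (∀ x y : Fin n, (pos y).1.val = (pos x).1.val + 1 → (pos y).2 = (pos x).2 →
    ¬ ltP n m (y.val + 1) (x.val + 1))

/-- `inv_G(T)` for `G = inc(P(m))`: the number of edges `{i,j}` of `G` with `i < j`
such that `i` appears in a strictly lower row of the tableau than `j`. -/
noncomputable def invG (n : ℕ) (m : ℕ → ℕ) (pos : Fin n → Fin n × Fin n) : ℕ :=
  ((Finset.univ : Finset (Fin n × Fin n)).filter
    (fun p => p.1 < p.2 ∧ p.2.val + 1 ≤ m (p.1.val + 1) ∧ (pos p.2).1 < (pos p.1).1)).card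

/-- The value of the tableau at the cell `(i, j)` (0-based) is `v`. -/
def EntryAt (n : ℕ) (pos : Fin n → Fin n × Fin n) (i j v : ℕ) : Prop :=
  ∃ x : Fin n, (pos x).1.val = i ∧ (pos x).2.val = j ∧ x.val + 1 = v

/-- The cell `(i, j)` (0-based) belongs to the Young diagram of shape `(2^k, 1^{n-2k})`. -/
def InTwoColumn (n k i j : ℕ) : Prop := (i < k ∧ j < 2) ∨ (k ≤ i ∧ i < n - k ∧ j = 0)

/-- A tableau of shape `(2^k, 1^{n-2k})` for the relation `R`, described by the natural number
coordinates of its cells. -/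
structure IsTwoColumnTab (n k : ℕ) (R : Fin n → Fin n → Prop) (pos : Fin n → Fin n × Fin n) :
    Prop where
  inj : Function.Injective pos
  mem : ∀ x, InTwoColumn n k (pos x).1.val (pos x).2.val
  surj : ∀ i j, InTwoColumn n k i j → ∃ x, (pos x).1.val = i ∧ (pos x).2.val = j
  row : ∀ x y, (pos y).1.val = (pos x).1.val → (pos y).2.val = (pos x).2.val + 1 → R x y
  col : ∀ x y, (pos y).1.val = (pos x).1.val + 1 → (pos y).2.val = (pos x).2.val → ¬ R y x

theorem inTwoColumn_iff {n k : ℕ} (hk : 2 * k ≤ n) (i j : ℕ) :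
    (i < (List.replicate k 2 ++ List.replicate (n - 2 * k) 1).length ∧
      j < (List.replicate k 2 ++ List.replicate (n - 2 * k) 1).getD i 0) ↔
    InTwoColumn n k i j := by
  unfold InTwoColumn
  simp only [List.length_append, List.length_replicate, List.getD_eq_getElem?_getD,
    List.getElem?_append, List.getElem?_replicate]
  split_ifs <;> simp <;> omega

theorem isPTab_iff_isTwoColumnTab {n k : ℕ} (hk : 2 * k ≤ n) (hn : 2 ≤ n) (m : ℕ → ℕ)
    (pos : Fin n → Fin n × Fin n) :
    IsPTab n m (List.replicate k 2 ++ List.replicate (n - 2 * k) 1) pos ↔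
      IsTwoColumnTab n k (fun x y => ltP n m (x.val + 1) (y.val + 1)) pos := by
  unfold IsPTab
  simp only [inTwoColumn_iff hk]
  constructor
  · rintro ⟨h1, h2, h3, h4⟩
    refine ⟨h1, fun x => (h2 _).1 ⟨x, rfl⟩, fun i j hij => ?_,
      fun x y h => h3 x y (Fin.ext h), fun x y h h' => h4 x y h (Fin.ext h')⟩
    have hi : i < n := by unfold InTwoColumn at hij; omega
    have hj : j < n := by unfold InTwoColumn at hij; omega
    obtain ⟨x, hx⟩ := (h2 (⟨i, hi⟩, ⟨j, hj⟩)).2 hij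
    exact ⟨x, by simp [hx]⟩
  · rintro ⟨h1, h2, h3, h4, h5⟩
    refine ⟨h1, fun c => ⟨?_, fun h => ?_⟩,
      fun x y h => h4 x y (congrArg Fin.val h),
      fun x y h h' => h5 x y h (congrArg Fin.val h')⟩
    · rintro ⟨x, rfl⟩
      exact h2 x
    · obtain ⟨x, hx, hx'⟩ := h3 _ _ h
      exact ⟨x, Prod.ext (Fin.ext hx) (Fin.ext hx')⟩

/-- Move the cell `(ℓ, 1)` into the first column just below row `ℓ + t`, pushing the cells
below that row one row down (coordinates are truncated to stay inside `Fin n`). -/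
def insertCell (n ℓ t : ℕ) (c : Fin n × Fin n) : Fin n × Fin n :=
  (⟨min (if c.1.val = ℓ ∧ c.2.val = 1 then ℓ + 1 + t
      else if c.1.val ≤ ℓ + t then c.1.val else c.1.val + 1) (n - 1),
    by have := c.1.isLt; omega⟩,
   ⟨if c.1.val = ℓ ∧ c.2.val = 1 then 0 else c.2.val, by have := c.2.isLt; split_ifs <;> omega⟩)

/-- Move the cell `(ℓ + 1 + t, 0)` to `(ℓ, 1)`, pulling the cells below it one row up
(coordinates are truncated to stay inside `Fin n`). -/
def removeCell (n ℓ t : ℕ) (c : Fin n × Fin n) : Fin n × Fin n :=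
  (⟨min (if c.1.val = ℓ + 1 + t then ℓ
      else if c.1.val ≤ ℓ + t then c.1.val else c.1.val - 1) (n - 1),
    by have := c.1.isLt; omega⟩,
   ⟨min (if c.1.val = ℓ + 1 + t then 1 else c.2.val) (n - 1), by have := c.2.isLt; omega⟩)

section Cells

variable {n ℓ t : ℕ} {c : Fin n × Fin n}

theorem insertCell_spec (ht : ℓ + 1 + t < n - ℓ)
    (hc : InTwoColumn n (ℓ + 1) c.1.val c.2.val) :
    InTwoColumn n ℓ (insertCell n ℓ t c).1.val (insertCell n ℓ t c).2.val ∧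
    ((c.1.val = ℓ ∧ c.2.val = 1 ∧ (insertCell n ℓ t c).1.val = ℓ + 1 + t ∧
        (insertCell n ℓ t c).2.val = 0) ∨
      (c.1.val ≤ ℓ + t ∧ (c.1.val = ℓ → c.2.val = 0) ∧
        (insertCell n ℓ t c).1.val = c.1.val ∧ (insertCell n ℓ t c).2.val = c.2.val) ∨
      (ℓ + t < c.1.val ∧ c.2.val = 0 ∧ (insertCell n ℓ t c).1.val = c.1.val + 1 ∧
        (insertCell n ℓ t c).2.val = 0)) := by
  unfold InTwoColumn insertCell at *
  dsimp only
  split_ifs <;> omega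

theorem removeCell_spec (ht : ℓ + 1 + t < n - ℓ)
    (hc : InTwoColumn n ℓ c.1.val c.2.val) :
    InTwoColumn n (ℓ + 1) (removeCell n ℓ t c).1.val (removeCell n ℓ t c).2.val ∧
    ((c.1.val = ℓ + 1 + t ∧ c.2.val = 0 ∧ (removeCell n ℓ t c).1.val = ℓ ∧
        (removeCell n ℓ t c).2.val = 1) ∨
      (c.1.val ≤ ℓ + t ∧ (ℓ ≤ c.1.val → c.2.val = 0) ∧
        (removeCell n ℓ t c).1.val = c.1.val ∧ (removeCell n ℓ t c).2.val = c.2.val) ∨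
      (ℓ + 1 + t < c.1.val ∧ c.2.val = 0 ∧ (removeCell n ℓ t c).1.val + 1 = c.1.val ∧
        (removeCell n ℓ t c).2.val = 0)) := by
  unfold InTwoColumn removeCell at *
  dsimp only
  split_ifs <;> omega

theorem removeCell_insertCell (ht : ℓ + 1 + t < n - ℓ)
    (hc : InTwoColumn n (ℓ + 1) c.1.val c.2.val) :
    removeCell n ℓ t (insertCell n ℓ t c) = c := by
  obtain ⟨h, h'⟩ := insertCell_spec ht hc
  obtain ⟨-, h''⟩ := removeCell_spec ht h
  exact Prod.ext (Fin.ext (by omega)) (Fin.ext (by omega))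

theorem insertCell_removeCell (ht : ℓ + 1 + t < n - ℓ)
    (hc : InTwoColumn n ℓ c.1.val c.2.val) :
    insertCell n ℓ t (removeCell n ℓ t c) = c := by
  obtain ⟨h, h'⟩ := removeCell_spec ht hc
  obtain ⟨-, h''⟩ := insertCell_spec ht h
  exact Prod.ext (Fin.ext (by omega)) (Fin.ext (by omega))

end Cells

/-- The entries strictly between rows `ℓ` and `ℓ + t + 1` are `R`-below the entry of the cell
`(ℓ, 1)`, and the entry of row `ℓ + t + 1`, if any, is not. -/
def HasRun (n ℓ t : ℕ) (R : Fin n → Fin n → Prop) (pos : Fin n → Fin n × Fin n) : Prop :=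
  ℓ + 1 + t < n - ℓ ∧ ∀ b x, (pos b).1.val = ℓ → (pos b).2.val = 1 →
    (ℓ < (pos x).1.val → (pos x).1.val ≤ ℓ + t → R x b) ∧
    ((pos x).1.val = ℓ + t + 1 → ¬ R x b)

/-- The entries of rows `ℓ, …, ℓ + t` are all `R`-below the entry of the cell
`(ℓ + 1 + t, 0)`. -/
def HasPeak (n ℓ t : ℕ) (R : Fin n → Fin n → Prop) (pos : Fin n → Fin n × Fin n) : Prop :=
  ℓ + 1 + t < n - ℓ ∧ ∀ b x, (pos b).1.val = ℓ + 1 + t → (pos b).2.val = 0 →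
    ℓ ≤ (pos x).1.val → (pos x).1.val ≤ ℓ + t → R x b

section Bijection

variable {n ℓ t t' : ℕ} {R : Fin n → Fin n → Prop} {pos : Fin n → Fin n × Fin n}

theorem IsTwoColumnTab.exists_hasRun (hl : 2 * ℓ + 2 ≤ n)
    (hT : IsTwoColumnTab n (ℓ + 1) R pos) : ∃ t, HasRun n ℓ t R pos := by
  obtain ⟨b, hb1, hb2⟩ := hT.surj ℓ 1 (by unfold InTwoColumn; omega)
  have hex : ∃ t, ∀ x, (pos x).1.val = ℓ + t + 1 → ¬ R x b :=
    ⟨n, fun x hx => by have := (pos x).1.isLt; omega⟩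
  have huniq : ∀ b', (pos b').1.val = ℓ → (pos b').2.val = 1 → b' = b := fun b' h1 h2 =>
    hT.inj (Prod.ext (Fin.ext (by omega)) (Fin.ext (by omega)))
  refine ⟨Nat.find hex, ?_, fun b' x h1 h2 => ?_⟩
  · have : Nat.find hex ≤ n - 2 * ℓ - 2 := Nat.find_min' hex fun x hx => by
      have := hT.mem x
      unfold InTwoColumn at this
      omega
    omega
  · obtain rfl := huniq b' h1 h2
    refine ⟨fun h3 h4 => ?_, Nat.find_spec hex x⟩
    have := Nat.find_min hex (m := (pos x).1.val - ℓ - 1) (by omega)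
    push Not at this
    obtain ⟨y, hy, hR⟩ := this
    have hx := hT.mem x
    have hy' := hT.mem y
    unfold InTwoColumn at hx hy'
    obtain rfl : y = x := hT.inj (Prod.ext (Fin.ext (by omega)) (Fin.ext (by omega)))
    exact hR

theorem IsTwoColumnTab.hasRun_unique (hT : IsTwoColumnTab n (ℓ + 1) R pos)
    (h : HasRun n ℓ t R pos) (h' : HasRun n ℓ t' R pos) : t = t' := by
  wlog hlt : t < t' generalizing t t'
  · by_contra hne
    exact hne (this h' h (by omega)).symm
  obtain ⟨b, hb1, hb2⟩ := hT.surj ℓ 1 (by unfold InTwoColumn; omega)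
  have := h'.1
  obtain ⟨x, hx, -⟩ := hT.surj (ℓ + t + 1) 0 (by unfold InTwoColumn; omega)
  exact absurd ((h'.2 b x hb1 hb2).1 (by omega) (by omega)) ((h.2 b x hb1 hb2).2 hx)

theorem IsTwoColumnTab.hasPeak_unique (bip : ∀ x y z, R x y → ¬ R y z)
    (hT : IsTwoColumnTab n ℓ R pos)
    (h : HasPeak n ℓ t R pos) (h' : HasPeak n ℓ t' R pos) : t = t' := by
  wlog hlt : t < t' generalizing t t'
  · by_contra hne
    exact hne (this h' h (by omega)).symm
  have h1 := h.1
  have h2 := h'.1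
  obtain ⟨x, hx, -⟩ := hT.surj ℓ 0 (by unfold InTwoColumn; omega)
  obtain ⟨y, hy, hy0⟩ := hT.surj (ℓ + 1 + t) 0 (by unfold InTwoColumn; omega)
  obtain ⟨z, hz, hz0⟩ := hT.surj (ℓ + 1 + t') 0 (by unfold InTwoColumn; omega)
  exact absurd (h'.2 z y hz hz0 (by omega) (by omega))
    (bip x y z (h.2 y x hy hy0 (by omega) (by omega)))

theorem IsTwoColumnTab.comp_insertCell (bip : ∀ x y z, R x y → ¬ R y z)
    (hT : IsTwoColumnTab n (ℓ + 1) R pos) (h : HasRun n ℓ t R pos) :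
    IsTwoColumnTab n ℓ R (insertCell n ℓ t ∘ pos) ∧
      HasPeak n ℓ t R (insertCell n ℓ t ∘ pos) := by
  have ht := h.1
  have spec := fun x => insertCell_spec ht (hT.mem x)
  obtain ⟨a, ha1, ha2⟩ := hT.surj ℓ 0 (by unfold InTwoColumn; omega)
  have hab : ∀ b, (pos b).1.val = ℓ → (pos b).2.val = 1 → R a b := fun b h1 h2 =>
    hT.row a b (by omega) (by omega)
  refine ⟨⟨fun x y hxy => ?_, fun x => (spec x).1, fun i j hij => ?_, fun x y h1 h2 => ?_,
    fun x y h1 h2 => ?_⟩, ht, fun b x h1 h2 h3 h4 => ?_⟩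
  · have := congrArg (removeCell n ℓ t) hxy
    simp only [Function.comp_apply, removeCell_insertCell ht (hT.mem _)] at this
    exact hT.inj this
  · have hi : i < n := by unfold InTwoColumn at hij; omega
    have hj : j < n := by unfold InTwoColumn at hij; omega
    obtain ⟨x, hx1, hx2⟩ := hT.surj _ _ (removeCell_spec (c := (⟨i, hi⟩, ⟨j, hj⟩)) ht hij).1
    refine ⟨x, ?_⟩
    have hx : pos x = removeCell n ℓ t (⟨i, hi⟩, ⟨j, hj⟩) :=
      Prod.ext (Fin.ext hx1) (Fin.ext hx2)
    simp [hx, insertCell_removeCell (c := (⟨i, hi⟩, ⟨j, hj⟩)) ht hij]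
  · have hx := spec x
    have hy := spec y
    simp only [Function.comp_apply] at h1 h2
    unfold InTwoColumn at hx hy
    exact hT.row x y (by omega) (by omega)
  · have hx := spec x
    have hy := spec y
    simp only [Function.comp_apply] at h1 h2
    by_cases hxb : (pos x).1.val = ℓ ∧ (pos x).2.val = 1
    · exact (h.2 x y hxb.1 hxb.2).2 (by omega)
    by_cases hyb : (pos y).1.val = ℓ ∧ (pos y).2.val = 1
    · exact bip a y x (hab y hyb.1 hyb.2)
    exact hT.col x y (by omega) (by omega)
  · have hx := spec x
    have hb := spec b
    simp only [Function.comp_apply] at h1 h2 h3 h4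
    by_cases hxa : (pos x).1.val = ℓ
    · exact hT.row x b (by omega) (by omega)
    · exact (h.2 b x (by omega) (by omega)).1 (by omega) (by omega)

theorem IsTwoColumnTab.comp_removeCell (bip : ∀ x y z, R x y → ¬ R y z)
    (hT : IsTwoColumnTab n ℓ R pos) (h : HasPeak n ℓ t R pos) :
    IsTwoColumnTab n (ℓ + 1) R (removeCell n ℓ t ∘ pos) ∧
      HasRun n ℓ t R (removeCell n ℓ t ∘ pos) := by
  have ht := h.1
  have spec := fun x => removeCell_spec ht (hT.mem x)
  obtain ⟨a, ha1, ha2⟩ := hT.surj ℓ 0 (by unfold InTwoColumn; omega)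
  obtain ⟨b, hb1, hb2⟩ := hT.surj (ℓ + 1 + t) 0 (by unfold InTwoColumn; omega)
  refine ⟨⟨fun x y hxy => ?_, fun x => (spec x).1, fun i j hij => ?_, fun x y h1 h2 => ?_,
    fun x y h1 h2 => ?_⟩, ht, fun b x h1 h2 => ⟨fun h3 h4 => ?_, fun h3 => ?_⟩⟩
  · have := congrArg (insertCell n ℓ t) hxy
    simp only [Function.comp_apply, insertCell_removeCell ht (hT.mem _)] at this
    exact hT.inj this
  · have hi : i < n := by unfold InTwoColumn at hij; omega
    have hj : j < n := by unfold InTwoColumn at hij; omega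
    obtain ⟨x, hx1, hx2⟩ := hT.surj _ _ (insertCell_spec (c := (⟨i, hi⟩, ⟨j, hj⟩)) ht hij).1
    refine ⟨x, ?_⟩
    have hx : pos x = insertCell n ℓ t (⟨i, hi⟩, ⟨j, hj⟩) :=
      Prod.ext (Fin.ext hx1) (Fin.ext hx2)
    simp [hx, removeCell_insertCell (c := (⟨i, hi⟩, ⟨j, hj⟩)) ht hij]
  · have hx := spec x
    have hy := spec y
    simp only [Function.comp_apply] at h1 h2
    by_cases hyb : (pos y).1.val = ℓ + 1 + t
    · exact h.2 y x hyb (by omega) (by omega) (by omega)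
    · unfold InTwoColumn at hx hy
      exact hT.row x y (by omega) (by omega)
  · have hx := spec x
    have hy := spec y
    simp only [Function.comp_apply] at h1 h2
    by_cases hyb : (pos y).1.val = ℓ + 1 + t
    · exact bip a y x (h.2 y a hyb (by omega) (by omega) (by omega))
    by_cases hxt : (pos x).1.val = ℓ + t
    · exact fun hR => bip y x b hR (h.2 b x hb1 hb2 (by omega) (by omega))
    unfold InTwoColumn at hx hy
    exact hT.col x y (by omega) (by omega)
  · have hx := spec x
    have hb := spec b
    simp only [Function.comp_apply] at h1 h2 h3 h4
    unfold InTwoColumn at hx hb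
    exact h.2 b x (by omega) (by omega) (by omega) (by omega)
  · have hx := spec x
    have hb := spec b
    simp only [Function.comp_apply] at h1 h2 h3
    unfold InTwoColumn at hx hb
    exact hT.col b x (by omega) (by omega)

theorem IsTwoColumnTab.insertCell_row_lt_iff
    (hT : IsTwoColumnTab n (ℓ + 1) R pos) (h : HasRun n ℓ t R pos) {x y : Fin n}
    (hxy : ¬ R x y) (hyx : ¬ R y x) :
    (insertCell n ℓ t (pos y)).1 < (insertCell n ℓ t (pos x)).1 ↔
      (pos y).1 < (pos x).1 := by
  have hx := (insertCell_spec h.1 (hT.mem x)).2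
  have hy := (insertCell_spec h.1 (hT.mem y)).2
  have key : ∀ b z, (pos b).1.val = ℓ → (pos b).2.val = 1 → ¬ R z b → z ≠ b →
      (pos z).1.val < ℓ ∨ ℓ + t < (pos z).1.val := by
    intro b z h1 h2 hR hne
    by_contra hcon
    rcases Nat.lt_or_ge ℓ (pos z).1.val with hz | hz
    · exact hR ((h.2 b z h1 h2).1 hz (by omega))
    · have := hT.mem z
      unfold InTwoColumn at this
      by_cases hz1 : (pos z).2.val = 1
      · exact hne (hT.inj (Prod.ext (Fin.ext (by omega)) (Fin.ext (by omega))))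
      · exact hR (hT.row z b (by omega) (by omega))
  rcases eq_or_ne x y with rfl | hne
  · simp
  have hkx := fun h1 h2 => key x y h1 h2 hyx hne.symm
  have hky := fun h1 h2 => key y x h1 h2 hxy hne
  simp only [Fin.lt_def]
  omega

theorem sum_isTwoColumnTab_eq {M : Type*} [AddCommMonoid M] (hl : 2 * ℓ + 2 ≤ n)
    (bip : ∀ x y z, R x y → ¬ R y z) (f : (Fin n → Fin n × Fin n) → M)
    (hf : ∀ pos t, IsTwoColumnTab n (ℓ + 1) R pos → HasRun n ℓ t R pos →
      f (insertCell n ℓ t ∘ pos) = f pos) :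
    ∑ pos with IsTwoColumnTab n (ℓ + 1) R pos, f pos =
      ∑ pos with IsTwoColumnTab n ℓ R pos ∧ ∃ t, HasPeak n ℓ t R pos, f pos := by
  have hrun : ∀ pos ∈ Finset.univ.filter (IsTwoColumnTab n (ℓ + 1) R),
      ∃ t, HasRun n ℓ t R pos := fun pos hpos =>
    (Finset.mem_filter.1 hpos).2.exists_hasRun hl
  choose t ht using hrun
  refine Finset.sum_bij (fun pos hpos => insertCell n ℓ (t pos hpos) ∘ pos)
    (fun pos hpos => ?_) (fun p hp q hq hpq => ?_) (fun q hq => ?_) (fun pos hpos => ?_)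
  · have := (Finset.mem_filter.1 hpos).2.comp_insertCell bip (ht pos hpos)
    exact Finset.mem_filter.2 ⟨Finset.mem_univ _, this.1, _, this.2⟩
  · have hpT := (Finset.mem_filter.1 hp).2
    have hqT := (Finset.mem_filter.1 hq).2
    have hp' := hpT.comp_insertCell bip (ht p hp)
    have hq' := hqT.comp_insertCell bip (ht q hq)
    rw [← hpq] at hq'
    have htt := hp'.1.hasPeak_unique bip hp'.2 hq'.2
    funext x
    have hx := congrArg (removeCell n ℓ (t p hp)) (congrFun hpq x)
    simp only [Function.comp_apply] at hx
    rw [removeCell_insertCell (ht p hp).1 (hpT.mem x), htt,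
      removeCell_insertCell (ht q hq).1 (hqT.mem x)] at hx
    exact hx
  · obtain ⟨-, hqT, s, hs⟩ := Finset.mem_filter.1 hq
    have h := hqT.comp_removeCell bip hs
    have hmem : removeCell n ℓ s ∘ q ∈
        Finset.univ.filter (IsTwoColumnTab n (ℓ + 1) R) :=
      Finset.mem_filter.2 ⟨Finset.mem_univ _, h.1⟩
    refine ⟨_, hmem, ?_⟩
    rw [h.1.hasRun_unique (ht _ hmem) h.2]
    funext x
    exact insertCell_removeCell hs.1 (hqT.mem x)
  · exact (hf pos _ (Finset.mem_filter.1 hpos).2 (ht pos hpos)).symm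

theorem IsTwoColumnTab.exists_hasPeak_iff {m : ℕ → ℕ}
    (hT : IsTwoColumnTab n ℓ (fun x y => ltP n m (x.val + 1) (y.val + 1)) pos) :
    (∃ s, ℓ + 2 ≤ s ∧ s ≤ n - ℓ ∧ ∀ i, ℓ + 1 ≤ i → i ≤ s - 1 →
      ∀ u v : ℕ, EntryAt n pos (i - 1) 0 u → EntryAt n pos (s - 1) 0 v → ltP n m u v) ↔
    ∃ t, HasPeak n ℓ t (fun x y => ltP n m (x.val + 1) (y.val + 1)) pos := by
  constructor
  · rintro ⟨s, h1, h2, h⟩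
    refine ⟨s - ℓ - 2, by omega, fun b x hb hb0 hx hx' => ?_⟩
    have hx0 := hT.mem x
    unfold InTwoColumn at hx0
    exact h ((pos x).1.val + 1) (by omega) (by omega) _ _ ⟨x, by omega, by omega, rfl⟩
      ⟨b, by omega, by omega, rfl⟩
  · rintro ⟨t, ht, h⟩
    refine ⟨ℓ + 2 + t, by omega, by omega, ?_⟩
    rintro i hi hi' _ _ ⟨x, hx, hx0, rfl⟩ ⟨b, hb, hb0, rfl⟩
    exact h b x (by omega) (by omega) (by omega) (by omega)

end Bijection

/-- Let `P = P(m)` with `m 1 = r`, `1 ≤ r ≤ n-2` and `m i = n` for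
`r+1 ≤ i ≤ n-1`. Fix `ℓ` with `2ℓ+2 ≤ n`. Then the inv-generating polynomial of the
`P`-tableaux of shape `(2^{ℓ+1}, 1^{n-2ℓ-2})` equals the inv-generating polynomial of
the set `T'_ℓ` of `P`-tableaux of shape `(2^ℓ, 1^{n-2ℓ})` possessing an `s` with
`ℓ+2 ≤ s ≤ n-ℓ` such that `a_{i,1} <_P a_{s,1}` for all `ℓ+1 ≤ i ≤ s-1`
(rows 1-based here, matching the paper). -/
theorem stmt_5 (n r : ℕ) (hr1 : 1 ≤ r) (hr2 : r ≤ n - 2) (m : ℕ → ℕ)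
    (hmono : ∀ i j, 1 ≤ i → i ≤ j → j ≤ n - 1 → m i ≤ m j)
    (hle : ∀ i, 1 ≤ i → i ≤ n - 1 → m i ≤ n)
    (hge : ∀ i, 1 ≤ i → i ≤ n - 1 → i ≤ m i)
    (hm1 : m 1 = r)
    (hmtop : ∀ i, r + 1 ≤ i → i ≤ n - 1 → m i = n)
    (ℓ : ℕ) (hl : 2 * ℓ + 2 ≤ n) :
    ∑ pos ∈ (Finset.univ : Finset (Fin n → Fin n × Fin n)).filter
        (IsPTab n m (List.replicate (ℓ + 1) 2 ++ List.replicate (n - 2 * ℓ - 2) 1)),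
      (Polynomial.X : Polynomial ℤ) ^ invG n m pos
    = ∑ pos ∈ (Finset.univ : Finset (Fin n → Fin n × Fin n)).filter
        (fun pos => IsPTab n m (List.replicate ℓ 2 ++ List.replicate (n - 2 * ℓ) 1) pos ∧
          ∃ s, ℓ + 2 ≤ s ∧ s ≤ n - ℓ ∧
            ∀ i, ℓ + 1 ≤ i → i ≤ s - 1 →
              ∀ u v : ℕ, EntryAt n pos (i - 1) 0 u → EntryAt n pos (s - 1) 0 v →
                ltP n m u v),
      (Polynomial.X : Polynomial ℤ) ^ invG n m pos := by
  have hlt : ∀ x y : Fin n, ltP n m (x.val + 1) (y.val + 1) → x.val < r ∧ r ≤ y.val := by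
    rintro x y ⟨h1, h2⟩
    have hx : x.val < r := by
      by_contra hx
      have := hmtop (x.val + 1) (by omega) h1
      have := y.isLt
      omega
    have := hmono 1 (x.val + 1) le_rfl (by omega) h1
    omega
  have hshape : n - 2 * ℓ - 2 = n - 2 * (ℓ + 1) := by omega
  rw [hshape]
  simp only [isPTab_iff_isTwoColumnTab (show 2 * (ℓ + 1) ≤ n by omega) (by omega),
    isPTab_iff_isTwoColumnTab (show 2 * ℓ ≤ n by omega) (by omega)]
  rw [sum_isTwoColumnTab_eq hl (fun x y z hxy hyz => by
    have := hlt x y hxy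
    have := hlt y z hyz
    omega)]
  · refine Finset.sum_congr (Finset.filter_congr fun pos _ => ?_) fun _ _ => rfl
    exact and_congr_right fun hT => hT.exists_hasPeak_iff.symm
  · intro pos t hT ht
    congr 1
    unfold invG
    congr 1
    refine Finset.filter_congr fun p _ => and_congr_right fun hp => and_congr_right fun he => ?_
    refine hT.insertCell_row_lt_iff ht (fun h => ?_) (fun h => ?_)
    · have := h.2
      omega
    · have := hlt _ _ h
      have := Fin.lt_def.1 hp
      omega
end

section
/- Let n ≥ 5 and let r, s be integers with 2 ≤ r < s ≤ n−2. Let P = P(m) be the natural unit interval order on {1,…,n} with m_1 = r, m_i = n−1 for 2 ≤ i ≤ s, and m_i = n for s+1 ≤ i ≤ n−1, and let G = inc(P). Then every coefficient of the polynomial B_{(3,1^{n−3})}(t) is less than or equal to the corresponding coefficient of B_{(2,2,1^{n−4})}(t). -/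
open scoped Classical

/-- `B_λ(t) = Σ_T t^{inv_G(T)}`, summed over all `P(m)`-tableaux of shape `lam`. -/
noncomputable def Bpoly (n : ℕ) (m : ℕ → ℕ) (lam : List ℕ) : Polynomial ℤ :=
  ∑ pos ∈ (Finset.univ : Finset (Fin n → Fin n × Fin n)).filter (IsPTab n m lam),
    Polynomial.X ^ invG n m pos

theorem Bpoly_coeff (n : ℕ) (m : ℕ → ℕ) (lam : List ℕ) (i : ℕ) :
    (Bpoly n m lam).coeff i =
      (((Finset.univ : Finset (Fin n → Fin n × Fin n)).filter
        (fun pos => IsPTab n m lam pos ∧ invG n m pos = i)).card : ℤ) := by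
  simp only [Bpoly, Polynomial.finsetSum_coeff, Polynomial.coeff_X_pow, eq_comm (a := i)]
  rw [Finset.sum_boole, Finset.filter_filter]

theorem mem_hook_iff (n u v : ℕ) (hn : 5 ≤ n) :
    (u < (3 :: List.replicate (n - 3) 1).length ∧
      v < (3 :: List.replicate (n - 3) 1).getD u 0) ↔
    (u = 0 ∧ v < 3) ∨ (1 ≤ u ∧ u < n - 2 ∧ v = 0) := by
  rcases u with _ | u
  · simp
  · simp only [List.length_cons, List.length_replicate, List.getD_cons_succ]
    by_cases h : u < n - 3
    · rw [List.getD_replicate _ h]; omega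
    · omega

theorem mem_twoTwoHook_iff (n u v : ℕ) (hn : 5 ≤ n) :
    (u < (2 :: 2 :: List.replicate (n - 4) 1).length ∧
      v < (2 :: 2 :: List.replicate (n - 4) 1).getD u 0) ↔
    (u ≤ 1 ∧ v < 2) ∨ (2 ≤ u ∧ u < n - 2 ∧ v = 0) := by
  rcases u with _ | _ | u
  · simp
  · simp
  · simp only [List.length_cons, List.length_replicate, List.getD_cons_succ]
    by_cases h : u < n - 4
    · rw [List.getD_replicate _ h]; omega
    · omega

/-- The cell in row `u` and column `v` of the top left `3 × 3` corner. -/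
def cornerCell {n : ℕ} (hn : 3 ≤ n) (u v : Fin 3) : Fin n × Fin n :=
  (Fin.castLE hn u, Fin.castLE hn v)

theorem cornerCell_inj {n : ℕ} (hn : 3 ≤ n) {u v u' v' : Fin 3} :
    cornerCell hn u v = cornerCell hn u' v' ↔ u = u' ∧ v = v' := by
  simp [cornerCell, Prod.ext_iff]

theorem eq_cornerCell_iff {n : ℕ} (hn : 3 ≤ n) {u v : Fin 3} {c : Fin n × Fin n} :
    c = cornerCell hn u v ↔ c.1.val = u.val ∧ c.2.val = v.val := by
  simp [cornerCell, Prod.ext_iff, Fin.ext_iff]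

/-- The permutation of cells moving the end of the first row of the hook to the cell `(1, 1)`. -/
def moveEnd {n : ℕ} (hn : 3 ≤ n) : Equiv.Perm (Fin n × Fin n) :=
  Equiv.swap (cornerCell hn 0 2) (cornerCell hn 1 1)

/-- The permutation of cells that exchanges `(0, 1)` with `(1, 0)` and then applies `moveEnd`. -/
def moveEndSwap {n : ℕ} (hn : 3 ≤ n) : Equiv.Perm (Fin n × Fin n) :=
  (Equiv.swap (cornerCell hn 0 1) (cornerCell hn 1 0)).trans (moveEnd hn)

theorem moveEnd_apply_of_ne {n : ℕ} (hn : 3 ≤ n) {c : Fin n × Fin n}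
    (h : c ≠ cornerCell hn 0 2) (h' : c ≠ cornerCell hn 1 1) : moveEnd hn c = c :=
  Equiv.swap_apply_of_ne_of_ne h h'

theorem moveEndSwap_apply_of_ne {n : ℕ} (hn : 3 ≤ n) {c : Fin n × Fin n}
    (h : c ≠ cornerCell hn 0 1) (h' : c ≠ cornerCell hn 1 0) :
    moveEndSwap hn c = moveEnd hn c := by
  rw [moveEndSwap, Equiv.trans_apply, Equiv.swap_apply_of_ne_of_ne h h']

theorem moveEnd_02 {n : ℕ} (hn : 3 ≤ n) :
    moveEnd hn (cornerCell hn 0 2) = cornerCell hn 1 1 :=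
  Equiv.swap_apply_left _ _

theorem moveEnd_cornerCell_of_ne {n : ℕ} (hn : 3 ≤ n) {u v : Fin 3}
    (h : ¬(u = 0 ∧ v = 2)) (h' : ¬(u = 1 ∧ v = 1)) :
    moveEnd hn (cornerCell hn u v) = cornerCell hn u v :=
  moveEnd_apply_of_ne hn (mt (cornerCell_inj hn).1 h) (mt (cornerCell_inj hn).1 h')

theorem moveEndSwap_01 {n : ℕ} (hn : 3 ≤ n) :
    moveEndSwap hn (cornerCell hn 0 1) = cornerCell hn 1 0 := by
  rw [moveEndSwap, Equiv.trans_apply, Equiv.swap_apply_left,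
    moveEnd_cornerCell_of_ne hn (by decide) (by decide)]

theorem moveEndSwap_10 {n : ℕ} (hn : 3 ≤ n) :
    moveEndSwap hn (cornerCell hn 1 0) = cornerCell hn 0 1 := by
  rw [moveEndSwap, Equiv.trans_apply, Equiv.swap_apply_right,
    moveEnd_cornerCell_of_ne hn (by decide) (by decide)]

theorem moveEndSwap_cornerCell_of_ne {n : ℕ} (hn : 3 ≤ n) {u v : Fin 3}
    (h : ¬(u = 0 ∧ v = 1)) (h' : ¬(u = 1 ∧ v = 0)) :
    moveEndSwap hn (cornerCell hn u v) = moveEnd hn (cornerCell hn u v) :=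
  moveEndSwap_apply_of_ne hn (mt (cornerCell_inj hn).1 h) (mt (cornerCell_inj hn).1 h')

/-- A filling of the hook `(3, 1^{n-3})` whose first row is `z, a, e` and whose second row is `c`,
where values are shifted by one. -/
structure IsHookFilling (n r s : ℕ) (hn : 3 ≤ n) (pos : Fin n → Fin n × Fin n)
    (z a e c : Fin n) : Prop where
  injective : Function.Injective pos
  pos_z : pos z = cornerCell hn 0 0
  pos_a : pos a = cornerCell hn 0 1
  pos_e : pos e = cornerCell hn 0 2
  pos_c : pos c = cornerCell hn 1 0
  z_eq : z.val = 0
  le_a : r ≤ a.val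
  a_lt : a.val < s
  e_eq : e.val = n - 1
  c_pos : 0 < c.val
  c_lt : c.val < n - 1
  c_ne : c.val ≠ a.val
  rest : ∀ x, x ≠ z → x ≠ a → x ≠ e → x ≠ c → 2 ≤ (pos x).1.val ∧ (pos x).2.val = 0
  surj : ∀ u : Fin n × Fin n, 2 ≤ u.1.val → u.1.val < n - 2 → u.2.val = 0 → ∃ x, pos x = u
  row_lt : ∀ x, (pos x).1.val < n - 2

/-- The order relation defined by `m` is the one with parameters `r` and `s`. -/
def IsOrderRS (n r s : ℕ) (m : ℕ → ℕ) : Prop :=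
  ∀ x y : ℕ, x < n → y < n →
    (ltP n m (x + 1) (y + 1) ↔ (x = 0 ∧ r ≤ y) ∨ (x < s ∧ y = n - 1))

theorem isOrderRS (n r s : ℕ) (hr : 2 ≤ r) (hrs : r < s) (hs : s ≤ n - 2)
    (m : ℕ → ℕ) (hm1 : m 1 = r)
    (hmmid : ∀ i, 2 ≤ i → i ≤ s → m i = n - 1)
    (hmtop : ∀ i, s + 1 ≤ i → i ≤ n - 1 → m i = n) : IsOrderRS n r s m := by
  intro x y hx hy
  unfold ltP
  rcases Nat.eq_zero_or_pos x with rfl | h0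
  · rw [zero_add, hm1]; omega
  by_cases h1 : x + 1 ≤ s
  · rw [hmmid _ (by omega) h1]; omega
  by_cases h2 : x + 1 ≤ n - 1
  · rw [hmtop _ (by omega) h2]; omega
  · omega

theorem IsPTab.exists_isHookFilling {n r s : ℕ} {m : ℕ → ℕ} {pos : Fin n → Fin n × Fin n}
    (hn : 5 ≤ n) (hr : 2 ≤ r) (hrs : r < s) (hs : s ≤ n - 2) (hm : IsOrderRS n r s m)
    (h : IsPTab n m (3 :: List.replicate (n - 3) 1) pos) :
    ∃ z a e c, IsHookFilling n r s (by omega) pos z a e c := by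
  obtain ⟨hinj, hcell, hrow, -⟩ := h
  simp only [mem_hook_iff n _ _ hn] at hcell
  have h3 : 3 ≤ n := by omega
  obtain ⟨z, hz⟩ := (hcell (cornerCell h3 0 0)).2 (by simp [cornerCell])
  obtain ⟨a, ha⟩ := (hcell (cornerCell h3 0 1)).2 (by simp [cornerCell])
  obtain ⟨e, he⟩ := (hcell (cornerCell h3 0 2)).2 (by simp [cornerCell])
  obtain ⟨c, hc⟩ := (hcell (cornerCell h3 1 0)).2 (by simp [cornerCell]; omega)
  have hza := (hm _ _ z.2 a.2).1 (hrow z a (by rw [hz, ha]; rfl) (by rw [hz, ha]; rfl))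
  have hae := (hm _ _ a.2 e.2).1 (hrow a e (by rw [ha, he]; rfl) (by rw [ha, he]; rfl))
  have hne : ∀ {x y : Fin n} {u v u' v' : Fin 3}, pos x = cornerCell h3 u v →
      pos y = cornerCell h3 u' v' → ¬(u = u' ∧ v = v') → x.val ≠ y.val := by
    intro x y u v u' v' hx hy huv hxy
    obtain rfl := Fin.ext hxy
    exact huv ((cornerCell_inj h3).1 (hx.symm.trans hy))
  have hcz := hne hc hz (by decide)
  have hca := hne hc ha (by decide)
  have hce := hne hc he (by decide)
  have hcn := c.2
  refine ⟨z, a, e, c, hinj, hz, ha, he, hc, by omega, by omega, by omega, by omega, by omega,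
    by omega, hca, ?_, ?_, ?_⟩
  · intro x xz xa xe xc
    have hx := (hcell (pos x)).1 ⟨x, rfl⟩
    have k0 := mt (fun k : pos x = cornerCell h3 0 0 => hinj (k.trans hz.symm)) xz
    have k1 := mt (fun k : pos x = cornerCell h3 0 1 => hinj (k.trans ha.symm)) xa
    have k2 := mt (fun k : pos x = cornerCell h3 0 2 => hinj (k.trans he.symm)) xe
    have k3 := mt (fun k : pos x = cornerCell h3 1 0 => hinj (k.trans hc.symm)) xc
    simp only [eq_cornerCell_iff, Fin.isValue, Fin.val_zero, Fin.val_one, Fin.val_two]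
      at k0 k1 k2 k3
    omega
  · intro u h2 h3 h4
    exact (hcell u).2 (by omega)
  · intro x
    have hx := (hcell (pos x)).1 ⟨x, rfl⟩
    omega

/-- A filling of the shape `(2, 2, 1^{n-4})` with the right relations is a tableau. -/
theorem isPTab_twoTwoHook {n r s : ℕ} {m : ℕ → ℕ} {pos : Fin n → Fin n × Fin n}
    (hn : 5 ≤ n) (hm : IsOrderRS n r s m) (h3 : 3 ≤ n) (z p q e : Fin n)
    (hinj : Function.Injective pos)
    (hz : pos z = cornerCell h3 0 0) (hp : pos p = cornerCell h3 0 1)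
    (hq : pos q = cornerCell h3 1 0) (he : pos e = cornerCell h3 1 1)
    (hz0 : z.val = 0) (hrp : r ≤ p.val) (hqs : q.val < s) (hen : e.val = n - 1)
    (hrest : ∀ x, x ≠ z → x ≠ p → x ≠ q → x ≠ e → 2 ≤ (pos x).1.val ∧ (pos x).2.val = 0)
    (hsurj : ∀ u : Fin n × Fin n, 2 ≤ u.1.val → u.1.val < n - 2 → u.2.val = 0 → ∃ x, pos x = u)
    (hrow : ∀ x, (pos x).1.val < n - 2) :
    IsPTab n m (2 :: 2 :: List.replicate (n - 4) 1) pos := by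
  have hcell : ∀ x, ((pos x).1.val ≤ 1 ∧ (pos x).2.val < 2) ∨
      (2 ≤ (pos x).1.val ∧ (pos x).1.val < n - 2 ∧ (pos x).2.val = 0) := by
    intro x
    by_cases h : x = z ∨ x = p ∨ x = q ∨ x = e
    · left
      rcases h with rfl | rfl | rfl | rfl <;> simp [*, cornerCell]
    · push Not at h
      have := hrest x h.1 h.2.1 h.2.2.1 h.2.2.2
      have := hrow x
      omega
  have hat : ∀ x y u v, pos y = cornerCell h3 u v → (pos x).1.val = u.val →
      (pos x).2.val = v.val → x = y := fun x y u v hy h1 h2 =>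
    hinj (((eq_cornerCell_iff h3).2 ⟨h1, h2⟩).trans hy.symm)
  refine ⟨hinj, ?_, ?_, ?_⟩
  · intro c
    rw [mem_twoTwoHook_iff n _ _ hn]
    constructor
    · rintro ⟨x, rfl⟩
      exact hcell x
    · rintro (⟨h1, h2⟩ | ⟨h1, h2, h4⟩)
      · have h1' : c.1.val = 0 ∨ c.1.val = 1 := by omega
        have h2' : c.2.val = 0 ∨ c.2.val = 1 := by omega
        rcases h1' with h1 | h1 <;> rcases h2' with h2 | h2
        · exact ⟨z, hz.trans ((eq_cornerCell_iff h3).2 ⟨h1, h2⟩).symm⟩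
        · exact ⟨p, hp.trans ((eq_cornerCell_iff h3).2 ⟨h1, h2⟩).symm⟩
        · exact ⟨q, hq.trans ((eq_cornerCell_iff h3).2 ⟨h1, h2⟩).symm⟩
        · exact ⟨e, he.trans ((eq_cornerCell_iff h3).2 ⟨h1, h2⟩).symm⟩
      · exact hsurj c h1 h2 h4
  · intro x y h1 h2
    rw [hm _ _ x.2 y.2]
    have h1 := congrArg Fin.val h1
    have hx := hcell x
    have hy := hcell y
    rcases (show (pos x).1.val = 0 ∨ (pos x).1.val = 1 by omega) with h0 | h0
    · obtain rfl := hat x z 0 0 hz h0 (by simp; omega)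
      obtain rfl := hat y p 0 1 hp (by simp; omega) (by simp; omega)
      omega
    · obtain rfl := hat x q 1 0 hq h0 (by simp; omega)
      obtain rfl := hat y e 1 1 he (by simp; omega) (by simp; omega)
      omega
  · intro x y h1 h2
    rw [hm _ _ y.2 x.2]
    have h2 := congrArg Fin.val h2
    rintro (⟨hy0, -⟩ | ⟨-, hxe⟩)
    · obtain rfl : y = z := Fin.ext (by omega)
      rw [hz] at h1
      simp [cornerCell] at h1
    · obtain rfl : x = e := Fin.ext (by omega)
      have hy := hcell y
      rw [he] at h1 h2
      simp [cornerCell] at h1 h2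
      omega

theorem edge_iff {n r s : ℕ} {m : ℕ → ℕ} (hm : IsOrderRS n r s m) {x y : Fin n} (hxy : x < y) :
    y.val + 1 ≤ m (x.val + 1) ↔ ¬((x.val = 0 ∧ r ≤ y.val) ∨ (x.val < s ∧ y.val = n - 1)) := by
  rw [← hm _ _ x.2 y.2, ltP]
  have := y.2
  omega

namespace IsHookFilling

variable {n r s : ℕ} {hn : 3 ≤ n} {m : ℕ → ℕ} {pos : Fin n → Fin n × Fin n} {z a e c : Fin n}

theorem ne_cell (h : IsHookFilling n r s hn pos z a e c) {x y : Fin n} {u v : Fin 3}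
    (hy : pos y = cornerCell hn u v) (hxy : x ≠ y) : pos x ≠ cornerCell hn u v :=
  fun k => hxy (h.injective (k.trans hy.symm))

theorem moveEnd_rest (h : IsHookFilling n r s hn pos z a e c) (x : Fin n)
    (hxz : x ≠ z) (hxa : x ≠ a) (hxe : x ≠ e) (hxc : x ≠ c) :
    moveEnd hn (pos x) = pos x := by
  refine moveEnd_apply_of_ne hn (h.ne_cell h.pos_e hxe) fun k => ?_
  have := (h.rest x hxz hxa hxe hxc).1
  rw [k] at this
  simp [cornerCell] at this

theorem moveEndSwap_rest (h : IsHookFilling n r s hn pos z a e c) (x : Fin n)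
    (hxz : x ≠ z) (hxa : x ≠ a) (hxe : x ≠ e) (hxc : x ≠ c) :
    moveEndSwap hn (pos x) = pos x := by
  rw [moveEndSwap_apply_of_ne hn (h.ne_cell h.pos_a hxa) (h.ne_cell h.pos_c hxc),
    h.moveEnd_rest x hxz hxa hxe hxc]

theorem moveEnd_z (h : IsHookFilling n r s hn pos z a e c) :
    moveEnd hn (pos z) = cornerCell hn 0 0 := by
  rw [h.pos_z, moveEnd_cornerCell_of_ne hn (by decide) (by decide)]

theorem moveEnd_a (h : IsHookFilling n r s hn pos z a e c) :
    moveEnd hn (pos a) = cornerCell hn 0 1 := by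
  rw [h.pos_a, moveEnd_cornerCell_of_ne hn (by decide) (by decide)]

theorem moveEnd_c (h : IsHookFilling n r s hn pos z a e c) :
    moveEnd hn (pos c) = cornerCell hn 1 0 := by
  rw [h.pos_c, moveEnd_cornerCell_of_ne hn (by decide) (by decide)]

theorem moveEnd_e (h : IsHookFilling n r s hn pos z a e c) :
    moveEnd hn (pos e) = cornerCell hn 1 1 := by
  rw [h.pos_e, moveEnd_02]

theorem moveEndSwap_z (h : IsHookFilling n r s hn pos z a e c) :
    moveEndSwap hn (pos z) = cornerCell hn 0 0 := by
  rw [h.pos_z, moveEndSwap_cornerCell_of_ne hn (by decide) (by decide),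
    moveEnd_cornerCell_of_ne hn (by decide) (by decide)]

theorem moveEndSwap_a (h : IsHookFilling n r s hn pos z a e c) :
    moveEndSwap hn (pos a) = cornerCell hn 1 0 := by
  rw [h.pos_a, moveEndSwap_01]

theorem moveEndSwap_c (h : IsHookFilling n r s hn pos z a e c) :
    moveEndSwap hn (pos c) = cornerCell hn 0 1 := by
  rw [h.pos_c, moveEndSwap_10]

theorem moveEndSwap_e (h : IsHookFilling n r s hn pos z a e c) :
    moveEndSwap hn (pos e) = cornerCell hn 1 1 := by
  rw [h.pos_e, moveEndSwap_cornerCell_of_ne hn (by decide) (by decide), moveEnd_02]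

theorem eq_of_row_two_le (h : IsHookFilling n r s hn pos z a e c) {x : Fin n}
    (hx : 2 ≤ (pos x).1.val) : x ≠ z ∧ x ≠ a ∧ x ≠ e ∧ x ≠ c := by
  refine ⟨?_, ?_, ?_, ?_⟩ <;> rintro rfl
  · rw [h.pos_z] at hx; simp [cornerCell] at hx
  · rw [h.pos_a] at hx; simp [cornerCell] at hx
  · rw [h.pos_e] at hx; simp [cornerCell] at hx
  · rw [h.pos_c] at hx; simp [cornerCell] at hx

theorem isPTab_moveEnd (h : IsHookFilling n r s hn pos z a e c) (h5 : 5 ≤ n)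
    (hm : IsOrderRS n r s m) (hc : c.val < s) :
    IsPTab n m (2 :: 2 :: List.replicate (n - 4) 1) (moveEnd hn ∘ pos) := by
  refine isPTab_twoTwoHook h5 hm hn z a c e ((moveEnd hn).injective.comp h.injective)
    h.moveEnd_z h.moveEnd_a h.moveEnd_c h.moveEnd_e h.z_eq h.le_a hc h.e_eq ?_ ?_ ?_
  · intro x xz xa xc xe
    rw [Function.comp_apply, h.moveEnd_rest x xz xa xe xc]
    exact h.rest x xz xa xe xc
  · intro u h1 h2 h4
    obtain ⟨x, rfl⟩ := h.surj u h1 h2 h4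
    obtain ⟨xz, xa, xe, xc⟩ := h.eq_of_row_two_le h1
    exact ⟨x, h.moveEnd_rest x xz xa xe xc⟩
  · intro x
    by_cases hx : x = z ∨ x = a ∨ x = e ∨ x = c
    · rcases hx with rfl | rfl | rfl | rfl <;>
        simp only [Function.comp_apply, h.moveEnd_z, h.moveEnd_a, h.moveEnd_e, h.moveEnd_c] <;>
        simp [cornerCell] <;> omega
    · push Not at hx
      rw [Function.comp_apply, h.moveEnd_rest x hx.1 hx.2.1 hx.2.2.1 hx.2.2.2]
      exact h.row_lt x

theorem isPTab_moveEndSwap (h : IsHookFilling n r s hn pos z a e c) (h5 : 5 ≤ n)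
    (hrs : r < s) (hm : IsOrderRS n r s m) (hc : s ≤ c.val) :
    IsPTab n m (2 :: 2 :: List.replicate (n - 4) 1) (moveEndSwap hn ∘ pos) := by
  refine isPTab_twoTwoHook h5 hm hn z c a e ((moveEndSwap hn).injective.comp h.injective)
    h.moveEndSwap_z h.moveEndSwap_c h.moveEndSwap_a h.moveEndSwap_e h.z_eq (by omega) h.a_lt
    h.e_eq ?_ ?_ ?_
  · intro x xz xc xa xe
    rw [Function.comp_apply, h.moveEndSwap_rest x xz xa xe xc]
    exact h.rest x xz xa xe xc
  · intro u h1 h2 h4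
    obtain ⟨x, rfl⟩ := h.surj u h1 h2 h4
    obtain ⟨xz, xa, xe, xc⟩ := h.eq_of_row_two_le h1
    exact ⟨x, h.moveEndSwap_rest x xz xa xe xc⟩
  · intro x
    by_cases hx : x = z ∨ x = a ∨ x = e ∨ x = c
    · rcases hx with rfl | rfl | rfl | rfl <;>
        simp only [Function.comp_apply, h.moveEndSwap_z, h.moveEndSwap_a, h.moveEndSwap_e,
          h.moveEndSwap_c] <;>
        simp [cornerCell] <;> omega
    · push Not at hx
      rw [Function.comp_apply, h.moveEndSwap_rest x hx.1 hx.2.1 hx.2.2.1 hx.2.2.2]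
      exact h.row_lt x

theorem rows_moveEnd (h : IsHookFilling n r s hn pos z a e c) (x : Fin n) :
    (x.val = 0 ∧ (pos x).1.val = 0 ∧ (moveEnd hn (pos x)).1.val = 0) ∨
    (x.val = a.val ∧ (pos x).1.val = 0 ∧ (moveEnd hn (pos x)).1.val = 0) ∨
    (x.val = n - 1 ∧ (pos x).1.val = 0 ∧ (moveEnd hn (pos x)).1.val = 1) ∨
    (x.val = c.val ∧ (pos x).1.val = 1 ∧ (moveEnd hn (pos x)).1.val = 1) ∨
    (2 ≤ (pos x).1.val ∧ (moveEnd hn (pos x)).1.val = (pos x).1.val ∧ x.val ≠ a.val ∧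
      x.val ≠ c.val ∧ x.val ≠ n - 1) := by
  by_cases xz : x = z
  · subst xz; left; rw [h.moveEnd_z, h.pos_z]; simp [cornerCell, h.z_eq]
  by_cases xa : x = a
  · subst xa; right; left; rw [h.moveEnd_a, h.pos_a]; simp [cornerCell]
  by_cases xe : x = e
  · subst xe; right; right; left; rw [h.moveEnd_e, h.pos_e]; simp [cornerCell, h.e_eq]
  by_cases xc : x = c
  · subst xc; right; right; right; left; rw [h.moveEnd_c, h.pos_c]; simp [cornerCell]
  · right; right; right; right
    refine ⟨(h.rest x xz xa xe xc).1, by rw [h.moveEnd_rest x xz xa xe xc], ?_, ?_, ?_⟩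
    · exact fun k => xa (Fin.ext k)
    · exact fun k => xc (Fin.ext k)
    · exact fun k => xe (Fin.ext (k.trans h.e_eq.symm))

theorem rows_moveEndSwap (h : IsHookFilling n r s hn pos z a e c) (x : Fin n) :
    (x.val = 0 ∧ (pos x).1.val = 0 ∧ (moveEndSwap hn (pos x)).1.val = 0) ∨
    (x.val = a.val ∧ (pos x).1.val = 0 ∧ (moveEndSwap hn (pos x)).1.val = 1) ∨
    (x.val = n - 1 ∧ (pos x).1.val = 0 ∧ (moveEndSwap hn (pos x)).1.val = 1) ∨
    (x.val = c.val ∧ (pos x).1.val = 1 ∧ (moveEndSwap hn (pos x)).1.val = 0) ∨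
    (2 ≤ (pos x).1.val ∧ (moveEndSwap hn (pos x)).1.val = (pos x).1.val ∧ x.val ≠ a.val ∧
      x.val ≠ c.val ∧ x.val ≠ n - 1) := by
  by_cases xz : x = z
  · subst xz; left; rw [h.moveEndSwap_z, h.pos_z]; simp [cornerCell, h.z_eq]
  by_cases xa : x = a
  · subst xa; right; left; rw [h.moveEndSwap_a, h.pos_a]; simp [cornerCell]
  by_cases xe : x = e
  · subst xe; right; right; left; rw [h.moveEndSwap_e, h.pos_e]; simp [cornerCell, h.e_eq]
  by_cases xc : x = c
  · subst xc; right; right; right; left; rw [h.moveEndSwap_c, h.pos_c]; simp [cornerCell]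
  · right; right; right; right
    refine ⟨(h.rest x xz xa xe xc).1, by rw [h.moveEndSwap_rest x xz xa xe xc], ?_, ?_, ?_⟩
    · exact fun k => xa (Fin.ext k)
    · exact fun k => xc (Fin.ext k)
    · exact fun k => xe (Fin.ext (k.trans h.e_eq.symm))

theorem invG_moveEnd (h : IsHookFilling n r s hn pos z a e c) (hm : IsOrderRS n r s m)
    (hc : c.val < s) : invG n m (moveEnd hn ∘ pos) = invG n m pos := by
  unfold invG
  congr 1
  refine Finset.filter_congr ?_
  rintro ⟨x, y⟩ -
  refine and_congr_right fun hxy => ?_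
  dsimp only at hxy ⊢
  rw [edge_iff hm hxy]
  simp only [Function.comp_apply, Fin.lt_def] at hxy ⊢
  have := h.rows_moveEnd x
  have := h.rows_moveEnd y
  have := h.a_lt
  omega

theorem invG_moveEndSwap (h : IsHookFilling n r s hn pos z a e c) (hr : 2 ≤ r)
    (hm : IsOrderRS n r s m) (hc : s ≤ c.val) :
    invG n m (moveEndSwap hn ∘ pos) = invG n m pos := by
  have ha := h.a_lt
  have hra := h.le_a
  have he := h.e_eq
  have hcn := h.c_lt
  unfold invG
  set S := (Finset.univ : Finset (Fin n × Fin n)).filter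
    (fun p => p.1 < p.2 ∧ p.2.val + 1 ≤ m (p.1.val + 1) ∧ (pos p.2).1 < (pos p.1).1) with hS
  have hce : (c, e) ∈ S := by
    have hlt : c < e := Fin.lt_def.2 (by omega)
    simp only [hS, Finset.mem_filter, Finset.mem_univ, true_and]
    rw [edge_iff hm hlt, h.pos_c, h.pos_e]
    exact ⟨hlt, by omega, Fin.lt_def.2 (by simp [cornerCell])⟩
  have hac : (a, c) ∉ S := by
    simp [hS, h.pos_c, h.pos_a, cornerCell]
  have key : (Finset.univ : Finset (Fin n × Fin n)).filter
      (fun p => p.1 < p.2 ∧ p.2.val + 1 ≤ m (p.1.val + 1) ∧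
        ((moveEndSwap hn ∘ pos) p.2).1 < ((moveEndSwap hn ∘ pos) p.1).1) =
      insert (a, c) (S.erase (c, e)) := by
    ext ⟨x, y⟩
    simp only [hS, Finset.mem_insert, Finset.mem_erase, Finset.mem_filter, Finset.mem_univ,
      true_and, Prod.mk.injEq, ne_eq, Function.comp_apply]
    by_cases hxy : x < y
    · rw [edge_iff hm hxy]
      simp only [Fin.lt_def, Fin.ext_iff] at hxy ⊢
      have := h.rows_moveEndSwap x
      have := h.rows_moveEndSwap y
      omega
    · simp only [Fin.lt_def, Fin.ext_iff] at hxy ⊢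
      omega
  rw [key, Finset.card_insert_of_notMem (fun k => hac (Finset.mem_of_mem_erase k)),
    Finset.card_erase_add_one hce]

end IsHookFilling

/-- The map from fillings of the hook to fillings of `(2, 2, 1^{n-4})`: the last entry of the first
row moves down, after an exchange if the entry of the cell `(1, 0)` is larger than `s`. -/
noncomputable def hookToTwoTwo {n : ℕ} (hn : 3 ≤ n) (s : ℕ) (pos : Fin n → Fin n × Fin n) :
    Fin n → Fin n × Fin n :=
  if ∃ x, pos x = cornerCell hn 1 0 ∧ s ≤ x.val then moveEndSwap hn ∘ pos else moveEnd hn ∘ pos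

theorem IsHookFilling.hookToTwoTwo_eq {n r s : ℕ} {hn : 3 ≤ n} {pos : Fin n → Fin n × Fin n}
    {z a e c : Fin n} (h : IsHookFilling n r s hn pos z a e c) :
    (s ≤ c.val ∧ hookToTwoTwo hn s pos = moveEndSwap hn ∘ pos) ∨
    (c.val < s ∧ hookToTwoTwo hn s pos = moveEnd hn ∘ pos) := by
  by_cases hc : s ≤ c.val
  · exact Or.inl ⟨hc, if_pos ⟨c, h.pos_c, hc⟩⟩
  · refine Or.inr ⟨not_le.1 hc, if_neg ?_⟩
    rintro ⟨x, hx, hsx⟩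
    obtain rfl := h.injective (hx.trans h.pos_c.symm)
    exact hc hsx

theorem IsHookFilling.moveEndSwap_ne_moveEnd {n r s : ℕ} {hn : 3 ≤ n}
    {pos pos' : Fin n → Fin n × Fin n} {z a e c z' a' e' c' : Fin n}
    (h : IsHookFilling n r s hn pos z a e c) (h' : IsHookFilling n r s hn pos' z' a' e' c')
    (hc : s ≤ c.val) : moveEndSwap hn ∘ pos ≠ moveEnd hn ∘ pos' := by
  intro k
  have hca : c = a' := by
    apply (moveEnd hn).injective.comp h'.injective
    exact (congrFun k c).symm.trans (h.moveEndSwap_c.trans h'.moveEnd_a.symm)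
  have := h'.a_lt
  omega

/-- For the natural unit interval order with `m 1 = r`, `m i = n-1` for
`2 ≤ i ≤ s`, `m i = n` for `s+1 ≤ i ≤ n-1` (`n ≥ 5`, `2 ≤ r < s ≤ n-2`), every
coefficient of `B_{(3,1^{n-3})}(t)` is at most the corresponding coefficient of
`B_{(2,2,1^{n-4})}(t)`. -/
theorem stmt_10 (n r s : ℕ) (hn : 5 ≤ n) (hr : 2 ≤ r) (hrs : r < s) (hs : s ≤ n - 2)
    (m : ℕ → ℕ) (hm1 : m 1 = r)
    (hmmid : ∀ i, 2 ≤ i → i ≤ s → m i = n - 1)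
    (hmtop : ∀ i, s + 1 ≤ i → i ≤ n - 1 → m i = n) :
    ∀ i : ℕ, (Bpoly n m (3 :: List.replicate (n - 3) 1)).coeff i ≤
      (Bpoly n m (2 :: 2 :: List.replicate (n - 4) 1)).coeff i := by
  have hn3 : 3 ≤ n := by omega
  have hm := isOrderRS n r s hr hrs hs m hm1 hmmid hmtop
  intro i
  rw [Bpoly_coeff, Bpoly_coeff, Nat.cast_le]
  refine Finset.card_le_card_of_injOn (hookToTwoTwo hn3 s) ?_ ?_
  · intro pos hpos
    simp only [Finset.coe_filter, Finset.mem_univ, true_and, Set.mem_ofPred_eq] at hpos ⊢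
    obtain ⟨z, a, e, c, h⟩ := hpos.1.exists_isHookFilling hn hr hrs hs hm
    rw [← hpos.2]
    rcases h.hookToTwoTwo_eq with ⟨hc, k⟩ | ⟨hc, k⟩ <;> rw [k]
    · exact ⟨h.isPTab_moveEndSwap hn hrs hm hc, h.invG_moveEndSwap hr hm hc⟩
    · exact ⟨h.isPTab_moveEnd hn hm hc, h.invG_moveEnd hm hc⟩
  · intro pos hpos pos' hpos' heq
    simp only [Finset.coe_filter, Finset.mem_univ, true_and, Set.mem_ofPred_eq] at hpos hpos'
    obtain ⟨z, a, e, c, h⟩ := hpos.1.exists_isHookFilling hn hr hrs hs hm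
    obtain ⟨z', a', e', c', h'⟩ := hpos'.1.exists_isHookFilling hn hr hrs hs hm
    rcases h.hookToTwoTwo_eq with ⟨hc, k⟩ | ⟨hc, k⟩ <;>
      rcases h'.hookToTwoTwo_eq with ⟨hc', k'⟩ | ⟨hc', k'⟩ <;> rw [k, k'] at heq
    · exact (moveEndSwap hn3).injective.comp_left heq
    · exact (h.moveEndSwap_ne_moveEnd h' hc heq).elim
    · exact (h'.moveEndSwap_ne_moveEnd h hc' heq.symm).elim
    · exact (moveEnd hn3).injective.comp_left heq
end

section
/- Let n ≥ 5 and let r, s be integers with 2 ≤ r < s ≤ n−2. Let P = P(m) be the natural unit interval order on {1,…,n} with m_1 = r, m_i = n−1 for 2 ≤ i ≤ s, and m_i = n for s+1 ≤ i ≤ n−1, and let G = inc(P). Then every coefficient of the polynomial B_{(2,2,1^{n−4})}(t) + B_{(3,1^{n−3})}(t) is less than or equal to the corresponding coefficient of B_{(2,1^{n−2})}(t). -/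
open scoped Classical

/-- The cell of `x` is the one in row `i` and column `j`. -/
def CellAt {n : ℕ} (pos : Fin n → Fin n × Fin n) (x : Fin n) (i j : ℕ) : Prop :=
  (pos x).1.val = i ∧ (pos x).2.val = j

/-- The order `P(m)` of `stmt_11`, transported to the values `0, …, n - 1`. -/
def Below (n r s x y : ℕ) : Prop := (x = 0 ∧ r ≤ y) ∨ (1 ≤ x ∧ x < s ∧ y = n - 1)

/-- `q` arises from `p` by moving `e` into the first column, the rows from there on being
shifted down by one. -/
def InsertedInColumn {n : ℕ} (e : Fin n) (p q : Fin n → Fin n × Fin n) : Prop :=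
  (q e).2.val = 0 ∧ ∀ x, x ≠ e → (q x).2.val = (p x).2.val ∧
    ((p x).1.val < (q e).1.val → (q x).1.val = (p x).1.val) ∧
    ((q e).1.val ≤ (p x).1.val → (q x).1.val = (p x).1.val + 1)

/-- The graph of the injection from tableaux of shapes `(3,1^{n-3})` and `(2,2,1^{n-4})` to
tableaux of shape `(2,1^{n-2})`. -/
def Corresponds (n s : ℕ) (p q : Fin n → Fin n × Fin n) : Prop :=
  (∃ z e : Fin n, CellAt q z 0 1 ∧ z.val < s ∧ e.val = n - 1 ∧ CellAt p e 0 2 ∧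
    InsertedInColumn e p q) ∨
  (∃ z e : Fin n, CellAt q z 0 1 ∧ s ≤ z.val ∧ z.val ≠ n - 1 ∧ e.val = n - 1 ∧ CellAt p e 1 1 ∧
    InsertedInColumn e p q) ∨
  (∃ o l e : Fin n, o.val = 0 ∧ CellAt q o 0 0 ∧ l.val = n - 1 ∧ CellAt q l 0 1 ∧
    CellAt q e 1 0 ∧ CellAt p l 1 1 ∧ InsertedInColumn e (p ∘ Equiv.swap e l) q) ∨
  (∃ o l e : Fin n, o.val = 0 ∧ CellAt q o 1 0 ∧ l.val = n - 1 ∧ CellAt q l 0 1 ∧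
    CellAt q e 2 0 ∧ CellAt p e 1 1 ∧ InsertedInColumn e p q)

section Cells

variable {n : ℕ} {p q : Fin n → Fin n × Fin n}

lemma CellAt.eq_of_injective (hp : Function.Injective p) {x y : Fin n} {i j : ℕ}
    (hx : CellAt p x i j) (hy : CellAt p y i j) : x = y :=
  hp (Prod.ext (Fin.ext (hx.1.trans hy.1.symm)) (Fin.ext (hx.2.trans hy.2.symm)))

lemma InsertedInColumn.left_unique {e : Fin n} {p₁ p₂ : Fin n → Fin n × Fin n}
    (h₁ : InsertedInColumn e p₁ q) (h₂ : InsertedInColumn e p₂ q) (he : p₁ e = p₂ e) :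
    p₁ = p₂ := by
  funext x
  by_cases hx : x = e
  · rw [hx, he]
  · have a := h₁.2 x hx
    have b := h₂.2 x hx
    refine Prod.ext (Fin.ext ?_) (Fin.ext ?_) <;> omega

lemma Corresponds.left_unique {s : ℕ} (hs : s ≤ n - 2) (hn : 5 ≤ n)
    {p₁ p₂ : Fin n → Fin n × Fin n} (hq : Function.Injective q)
    (h₁ : Corresponds n s p₁ q) (h₂ : Corresponds n s p₂ q) : p₁ = p₂ := by
  have cell {e : Fin n} {i j : ℕ} {u v : Fin n → Fin n × Fin n} (hu : CellAt u e i j)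
      (hv : CellAt v e i j) : u e = v e :=
    Prod.ext (Fin.ext (hu.1.trans hv.1.symm)) (Fin.ext (hu.2.trans hv.2.symm))
  rcases h₁ with ⟨z, e, hz, hzs, he, hpe, hi⟩ | ⟨z, e, hz, hzs, hzn, he, hpe, hi⟩ |
      ⟨o, z, e, ho, hqo, hzs, hz, he, hpe, hi⟩ | ⟨o, z, e, ho, hqo, hzs, hz, he, hpe, hi⟩ <;>
  rcases h₂ with ⟨z', e', hz', hzs', he', hpe', hi'⟩ | ⟨z', e', hz', hzs', hzn', he', hpe', hi'⟩ |
      ⟨o', z', e', ho', hqo', hzs', hz', he', hpe', hi'⟩ |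
      ⟨o', z', e', ho', hqo', hzs', hz', he', hpe', hi'⟩ <;>
  obtain rfl := hz.eq_of_injective hq hz' <;>
  first
  | omega
  | (have hoo : o.val = o'.val := by omega
     obtain rfl : o = o' := Fin.ext hoo
     have := hqo.1
     have := hqo'.1
     omega)
  | (have hee : e.val = e'.val := by omega
     obtain rfl : e = e' := Fin.ext hee
     exact hi.left_unique hi' (cell hpe hpe'))
  | (obtain rfl := he.eq_of_injective hq he'
     exact hi.left_unique hi' (cell hpe hpe'))
  | (obtain rfl := he.eq_of_injective hq he'
     have := hi.left_unique hi' (by simpa using cell hpe hpe')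
     exact (Equiv.swap e z).surjective.injective_comp_right this)

lemma exists_insertedInColumn (hn : 5 ≤ n) (hp : Function.Injective p) {d₁ d₂ k : ℕ}
    (hd : 1 ≤ d₂) (hd' : ¬ (d₁ = 0 ∧ d₂ = 1))
    (hcells : ∀ i j, (∃ x, CellAt p x i j) ↔
      (j = 0 ∧ i < n - 2) ∨ (i = 0 ∧ j = 1) ∨ (i = d₁ ∧ j = d₂))
    {e : Fin n} (he : CellAt p e d₁ d₂) (hk : 1 ≤ k) (hkn : k ≤ n - 2) :
    ∃ q : Fin n → Fin n × Fin n, Function.Injective q ∧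
      (∀ i j, (∃ x, CellAt q x i j) ↔ (j = 0 ∧ i < n - 1) ∨ (i = 0 ∧ j = 1)) ∧
      (q e).1.val = k ∧ InsertedInColumn e p q := by
  let q : Fin n → Fin n × Fin n := fun x =>
    if x = e then (⟨k, by omega⟩, ⟨0, by omega⟩)
    else if (p x).1.val < k then p x
    else (⟨min ((p x).1.val + 1) (n - 1), by omega⟩, (p x).2)
  have hcell (x : Fin n) : ((p x).2.val = 0 ∧ (p x).1.val < n - 2) ∨
      ((p x).1.val = 0 ∧ (p x).2.val = 1) ∨ ((p x).1.val = d₁ ∧ (p x).2.val = d₂) :=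
    (hcells _ _).1 ⟨x, rfl, rfl⟩
  have hne (x : Fin n) (hx : x ≠ e) : ((p x).2.val = 0 ∧ (p x).1.val < n - 2) ∨
      ((p x).1.val = 0 ∧ (p x).2.val = 1) := by
    rcases hcell x with h | h | h
    · exact .inl h
    · exact .inr h
    · exact absurd (CellAt.eq_of_injective hp h he) hx
  have hqe : (q e).1.val = k ∧ (q e).2.val = 0 := by simp [q]
  have hqx (x : Fin n) (hx : x ≠ e) : (q x).2.val = (p x).2.val ∧
      ((p x).1.val < k → (q x).1.val = (p x).1.val) ∧
      (k ≤ (p x).1.val → (q x).1.val = (p x).1.val + 1) := by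
    have := hne x hx
    by_cases h : (p x).1.val < k
    · have hq : q x = p x := by simp only [q, if_neg hx, if_pos h]
      rw [hq]
      omega
    · have hq : q x = (⟨min ((p x).1.val + 1) (n - 1), by omega⟩, (p x).2) := by
        simp only [q, if_neg hx, if_neg h]
      have h₁ : (q x).1.val = min ((p x).1.val + 1) (n - 1) := by rw [hq]
      have h₂ : (q x).2.val = (p x).2.val := by rw [hq]
      omega
  refine ⟨q, ?_, ?_, hqe.1, hqe.2, ?_⟩
  · intro x y hxy
    have h1 : (q x).1.val = (q y).1.val := by rw [hxy]
    have h2 : (q x).2.val = (q y).2.val := by rw [hxy]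
    by_cases hx : x = e <;> by_cases hy : y = e
    · rw [hx, hy]
    · subst hx
      have := hqx y hy
      omega
    · subst hy
      have := hqx x hx
      omega
    · have := hqx x hx
      have := hqx y hy
      exact hp (Prod.ext (Fin.ext (by omega)) (Fin.ext (by omega)))
  · intro i j
    constructor
    · rintro ⟨x, h1, h2⟩
      by_cases hx : x = e
      · subst hx
        omega
      · have := hqx x hx
        have := hne x hx
        omega
    · intro h
      have of_cell (i' j' : ℕ) (hc : (j' = 0 ∧ i' < n - 2) ∨ (i' = 0 ∧ j' = 1)) :
          ∃ x, x ≠ e ∧ CellAt p x i' j' := by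
        obtain ⟨x, hx⟩ := (hcells i' j').2 (by omega)
        refine ⟨x, ?_, hx⟩
        rintro rfl
        have := he.1
        have := he.2
        have := hx.1
        have := hx.2
        omega
      rcases lt_trichotomy i k with hik | hik | hik
      · obtain ⟨x, hx, h1, h2⟩ := of_cell i j (by omega)
        have := hqx x hx
        exact ⟨x, by omega, by omega⟩
      · exact ⟨e, by omega, by omega⟩
      · obtain ⟨x, hx, h1, h2⟩ := of_cell (i - 1) j (by omega)
        have := hqx x hx
        exact ⟨x, by omega, by omega⟩
  · rw [hqe.1]
    exact hqx

end Cells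

section Tableaux

variable {n r s : ℕ} {m : ℕ → ℕ} {p q : Fin n → Fin n × Fin n}

lemma ltP_iff_below (hrs : r < s) (hs : s ≤ n - 2) (hm1 : m 1 = r)
    (hmmid : ∀ i, 2 ≤ i → i ≤ s → m i = n - 1)
    (hmtop : ∀ i, s + 1 ≤ i → i ≤ n - 1 → m i = n) (x y : Fin n) :
    ltP n m (x.val + 1) (y.val + 1) ↔ Below n r s x y := by
  unfold ltP Below
  rcases Nat.eq_zero_or_pos x.val with h | h
  · rw [h, zero_add, hm1]
    omega
  · rcases lt_or_ge x.val s with h' | h'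
    · rw [hmmid _ (by omega) (by omega)]
      omega
    · rcases lt_or_ge x.val (n - 1) with h'' | h''
      · rw [hmtop _ (by omega) (by omega)]
        omega
      · omega

lemma forall_cell_iff {Q : ℕ → ℕ → Prop} (hQ : ∀ i j, Q i j → i < n ∧ j < n) :
    (∀ c : Fin n × Fin n, (∃ x, p x = c) ↔ Q c.1 c.2) ↔
      ∀ i j, (∃ x, CellAt p x i j) ↔ Q i j := by
  constructor
  · intro h i j
    constructor
    · rintro ⟨x, rfl, rfl⟩
      exact (h _).1 ⟨x, rfl⟩
    · intro hij
      obtain ⟨x, hx⟩ := (h (⟨i, (hQ i j hij).1⟩, ⟨j, (hQ i j hij).2⟩)).2 hij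
      exact ⟨x, by simp [CellAt, hx]⟩
  · intro h c
    rw [← h]
    simp [CellAt, Prod.ext_iff, Fin.ext_iff]

lemma getD_replicate_one (a i : ℕ) :
    (List.replicate a 1).getD i 0 = if i < a then 1 else 0 := by
  by_cases h : i < a <;> simp [List.getD, h]

lemma cells_hook_two (hn : 5 ≤ n) :
    (∀ c : Fin n × Fin n, (∃ x, p x = c) ↔ c.1.val < (2 :: List.replicate (n - 2) 1).length ∧
      c.2.val < (2 :: List.replicate (n - 2) 1).getD c.1.val 0) ↔
    ∀ i j, (∃ x, CellAt p x i j) ↔ (j = 0 ∧ i < n - 1) ∨ (i = 0 ∧ j = 1) := by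
  rw [← forall_cell_iff (by omega)]
  refine forall_congr' fun c => iff_congr Iff.rfl ?_
  rcases c with ⟨⟨_ | i, hi⟩, ⟨j, hj⟩⟩
  · simp
    omega
  · simp only [List.getD_cons_succ, getD_replicate_one, List.length_cons, List.length_replicate]
    split_ifs <;> simp <;> omega

lemma cells_hook_three (hn : 5 ≤ n) :
    (∀ c : Fin n × Fin n, (∃ x, p x = c) ↔ c.1.val < (3 :: List.replicate (n - 3) 1).length ∧
      c.2.val < (3 :: List.replicate (n - 3) 1).getD c.1.val 0) ↔
    ∀ i j, (∃ x, CellAt p x i j) ↔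
      (j = 0 ∧ i < n - 2) ∨ (i = 0 ∧ j = 1) ∨ (i = 0 ∧ j = 2) := by
  rw [← forall_cell_iff (by omega)]
  refine forall_congr' fun c => iff_congr Iff.rfl ?_
  rcases c with ⟨⟨_ | i, hi⟩, ⟨j, hj⟩⟩
  · simp
    omega
  · simp only [List.getD_cons_succ, getD_replicate_one, List.length_cons, List.length_replicate]
    split_ifs <;> simp <;> omega

lemma cells_two_two (hn : 5 ≤ n) :
    (∀ c : Fin n × Fin n, (∃ x, p x = c) ↔ c.1.val < (2 :: 2 :: List.replicate (n - 4) 1).length ∧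
      c.2.val < (2 :: 2 :: List.replicate (n - 4) 1).getD c.1.val 0) ↔
    ∀ i j, (∃ x, CellAt p x i j) ↔
      (j = 0 ∧ i < n - 2) ∨ (i = 0 ∧ j = 1) ∨ (i = 1 ∧ j = 1) := by
  rw [← forall_cell_iff (by omega)]
  refine forall_congr' fun c => iff_congr Iff.rfl ?_
  rcases c with ⟨⟨_ | _ | i, hi⟩, ⟨j, hj⟩⟩
  · simp
    omega
  · simp
    omega
  · simp only [List.getD_cons_succ, getD_replicate_one, List.length_cons, List.length_replicate]
    split_ifs <;> simp <;> omega

lemma isPTab_hook_two (hn : 5 ≤ n)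
    (hL : ∀ x y : Fin n, ltP n m (x.val + 1) (y.val + 1) ↔ Below n r s x y)
    (hq : Function.Injective q)
    (hcells : ∀ i j, (∃ x, CellAt q x i j) ↔ (j = 0 ∧ i < n - 1) ∨ (i = 0 ∧ j = 1))
    (hrow : ∀ x y, CellAt q x 0 0 → CellAt q y 0 1 → Below n r s x y)
    (hcol : ∀ x y, (q x).2.val = 0 → (q y).2.val = 0 → (q y).1.val = (q x).1.val + 1 →
      ¬ Below n r s y x) :
    IsPTab n m (2 :: List.replicate (n - 2) 1) q := by
  have hcell (x : Fin n) := (hcells _ _).1 ⟨x, rfl, rfl⟩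
  refine ⟨hq, (cells_hook_two hn).2 hcells, fun x y h1 h2 => ?_, fun x y h1 h2 => ?_⟩
  · rw [hL]
    have h1 := congrArg Fin.val h1
    have := hcell x
    have := hcell y
    exact hrow x y ⟨by omega, by omega⟩ ⟨by omega, by omega⟩
  · rw [hL]
    have h2 := congrArg Fin.val h2
    have := hcell x
    have := hcell y
    exact hcol x y (by omega) (by omega) h1

lemma invG_congr
    (hL : ∀ x y : Fin n, ltP n m (x.val + 1) (y.val + 1) ↔ Below n r s x y)
    (h : ∀ x y : Fin n, x < y → ¬ Below n r s x y →
      ((q y).1.val < (q x).1.val ↔ (p y).1.val < (p x).1.val)) :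
    invG n m q = invG n m p := by
  unfold invG
  congr 1
  refine Finset.filter_congr fun c _ => and_congr_right fun hlt => and_congr_right fun hm => ?_
  refine h c.1 c.2 hlt ?_
  rw [← hL]
  exact fun hc => absurd hc.2 (by omega)

lemma exists_first_row (hn : 5 ≤ n) (hp : Function.Injective p) (hs : 1 ≤ s) {o : Fin n}
    (ho : o.val = 0) (hpo : CellAt p o 0 0) :
    ∃ k, 1 ≤ k ∧ k ≤ n - 2 ∧
      (∀ x : Fin n, s ≤ x.val → x.val ≠ n - 1 → (p x).2.val = 0 → k ≤ (p x).1.val) ∧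
      (k = n - 2 ∨ ∃ x : Fin n, s ≤ x.val ∧ x.val ≠ n - 1 ∧ CellAt p x k 0) := by
  let Q (k : ℕ) : Prop :=
    k = n - 2 ∨ ∃ x : Fin n, s ≤ x.val ∧ x.val ≠ n - 1 ∧ CellAt p x k 0
  have hQ : ∃ k, Q k := ⟨n - 2, .inl rfl⟩
  refine ⟨Nat.find hQ, ?_, Nat.find_min' hQ (.inl rfl),
    fun x h1 h2 h3 => Nat.find_min' hQ (.inr ⟨x, h1, h2, rfl, h3⟩), Nat.find_spec hQ⟩
  rw [Nat.one_le_iff_ne_zero]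
  intro h0
  have hspec := Nat.find_spec hQ
  rw [h0] at hspec
  rcases hspec with h | ⟨x, h1, h2, hx⟩
  · omega
  · have := CellAt.eq_of_injective hp hx hpo
    subst this
    omega

lemma exists_move_last (hn : 5 ≤ n) (hrs : r < s)
    (hL : ∀ x y : Fin n, ltP n m (x.val + 1) (y.val + 1) ↔ Below n r s x y)
    (hp : Function.Injective p) {d₁ d₂ : ℕ} (hd : 1 ≤ d₂) (hd' : ¬ (d₁ = 0 ∧ d₂ = 1))
    (hcells : ∀ i j, (∃ x, CellAt p x i j) ↔
      (j = 0 ∧ i < n - 2) ∨ (i = 0 ∧ j = 1) ∨ (i = d₁ ∧ j = d₂))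
    {o z l : Fin n} (ho : o.val = 0) (hpo : CellAt p o 0 0) (hz : r ≤ z.val)
    (hpz : CellAt p z 0 1) (hl : l.val = n - 1) (hpl : CellAt p l d₁ d₂)
    (hrows : ∀ x : Fin n, s ≤ x.val → x.val ≠ n - 1 → (p x).2.val = 0 → d₁ < (p x).1.val) :
    ∃ q, IsPTab n m (2 :: List.replicate (n - 2) 1) q ∧ invG n m q = invG n m p ∧
      CellAt q z 0 1 ∧ InsertedInColumn l p q := by
  obtain ⟨k, hk, hkn, hmin, hatt⟩ := exists_first_row hn hp (by omega : 1 ≤ s) ho hpo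
  obtain ⟨q, hq, hqcells, hqk, hins⟩ := exists_insertedInColumn hn hp hd hd' hcells hpl hk hkn
  have hcell (x : Fin n) := (hcells _ _).1 ⟨x, rfl, rfl⟩
  have hoth (x : Fin n) (hx : x ≠ l) : ((p x).2.val = 0 ∧ (p x).1.val < n - 2) ∨
      ((p x).1.val = 0 ∧ (p x).2.val = 1) := by
    rcases hcell x with h | h | h
    · exact .inl h
    · exact .inr h
    · exact absurd (CellAt.eq_of_injective hp h hpl) hx
  have hol : o ≠ l := by
    rintro rfl
    omega
  have hzl : z ≠ l := by
    rintro rfl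
    have := hpz.1
    have := hpz.2
    have := hpl.1
    have := hpl.2
    omega
  have hqo : CellAt q o 0 0 := by
    have := hins.2 o hol
    have := hpo.1
    have := hpo.2
    exact ⟨by omega, by omega⟩
  have hqz : CellAt q z 0 1 := by
    have := hins.2 z hzl
    have := hpz.1
    have := hpz.2
    exact ⟨by omega, by omega⟩
  refine ⟨q, isPTab_hook_two hn hL hq hqcells ?_ ?_, invG_congr hL ?_, hqz, hins⟩
  · intro x y hx hy
    obtain rfl := hx.eq_of_injective hq hqo
    obtain rfl := hy.eq_of_injective hq hqz
    exact .inl ⟨ho, hz⟩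
  · rintro x y hx hy hxy (⟨h1, -⟩ | ⟨h1, h2, h3⟩)
    · obtain rfl : y = o := Fin.ext (by omega)
      have := hqo.1
      omega
    · obtain rfl : x = l := Fin.ext (by omega)
      have hyx : y ≠ x := by
        rintro rfl
        omega
      have := hins.2 y hyx
      have := hoth y hyx
      rcases hatt with h | ⟨c, hc1, hc2, hc⟩
      · omega
      · have hyc : CellAt p y k 0 := ⟨by omega, by omega⟩
        obtain rfl := hyc.eq_of_injective hp hc
        omega
  · intro x y hxy hB
    have hxl : x ≠ l := by
      rintro rfl
      omega
    have h1 := hins.2 x hxl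
    have h2 := hoth x hxl
    by_cases hyl : y = l
    · subst hyl
      have hxo : x ≠ o := by
        rintro rfl
        exact hB (.inl ⟨ho, by omega⟩)
      have hx0 : x.val ≠ 0 := fun h => hxo (Fin.ext (h.trans ho.symm))
      have hxs : s ≤ x.val := by
        by_contra hlt
        exact hB (.inr ⟨by omega, by omega, hl⟩)
      have h3 := hmin x hxs (by omega)
      have h4 := hrows x hxs (by omega)
      have := hpl.1
      omega
    · have := hins.2 y hyl
      omega

/-- Rows `(1, b), (a, n)` with `b <_P n` become the row `(1, n)`, followed by `b`, `a`. -/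
lemma exists_swap_last (hn : 5 ≤ n) (hrs : r < s) (hs : s ≤ n - 2)
    (hL : ∀ x y : Fin n, ltP n m (x.val + 1) (y.val + 1) ↔ Below n r s x y)
    (hp : Function.Injective p)
    (hcells : ∀ i j, (∃ x, CellAt p x i j) ↔
      (j = 0 ∧ i < n - 2) ∨ (i = 0 ∧ j = 1) ∨ (i = 1 ∧ j = 1))
    {o z a l : Fin n} (ho : o.val = 0) (hpo : CellAt p o 0 0) (hz : 1 ≤ z.val)
    (hzs : z.val < s) (hpz : CellAt p z 0 1) (hpa : CellAt p a 1 0) (has : a.val < s)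
    (hl : l.val = n - 1) (hpl : CellAt p l 1 1) :
    ∃ q, IsPTab n m (2 :: List.replicate (n - 2) 1) q ∧ invG n m q = invG n m p ∧
      CellAt q o 0 0 ∧ CellAt q l 0 1 ∧ CellAt q z 1 0 ∧
      InsertedInColumn z (p ∘ Equiv.swap z l) q := by
  have hzl : z ≠ l := by
    rintro rfl
    omega
  set p' := p ∘ Equiv.swap z l with hp'
  have hp'z : p' z = p l := by simp [hp']
  have hp'l : p' l = p z := by simp [hp']
  have hp'x (x : Fin n) (h1 : x ≠ z) (h2 : x ≠ l) : p' x = p x := by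
    simp [hp', Equiv.swap_apply_of_ne_of_ne h1 h2]
  have hinj : Function.Injective p' := hp.comp (Equiv.swap z l).injective
  have hcells' : ∀ i j, (∃ x, CellAt p' x i j) ↔
      (j = 0 ∧ i < n - 2) ∨ (i = 0 ∧ j = 1) ∨ (i = 1 ∧ j = 1) := by
    intro i j
    rw [← hcells i j]
    exact (Equiv.swap z l).exists_congr_left.trans (by simp [CellAt, hp'])
  have hpz' : CellAt p' z 1 1 := by
    unfold CellAt
    rw [hp'z]
    exact hpl
  obtain ⟨q, hq, hqcells, hqk, hins⟩ :=
    exists_insertedInColumn hn hinj le_rfl (by omega) hcells' hpz' (k := 1) le_rfl (by omega)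
  have hoz : o ≠ z := by
    rintro rfl
    omega
  have hol : o ≠ l := by
    rintro rfl
    omega
  have hqz : CellAt q z 1 0 := ⟨hqk, hins.1⟩
  have hql : CellAt q l 0 1 := by
    have h := hins.2 l hzl.symm
    rw [hp'l] at h
    have := hpz.1
    have := hpz.2
    exact ⟨by omega, by omega⟩
  have hqx (x : Fin n) (h1 : x ≠ z) (h2 : x ≠ l) := hp'x x h1 h2 ▸ hins.2 x h1
  have hqo : CellAt q o 0 0 := by
    have := hqx o hoz hol
    have := hpo.1
    have := hpo.2
    exact ⟨by omega, by omega⟩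
  have hne (x : Fin n) (h1 : x ≠ z) (h2 : x ≠ l) (h3 : x ≠ o) :
      (p x).2.val = 0 ∧ 1 ≤ (p x).1.val := by
    rcases (hcells _ _).1 ⟨x, rfl, rfl⟩ with h | h | h
    · refine ⟨h.1, Nat.one_le_iff_ne_zero.2 fun h0 => h3 ?_⟩
      exact CellAt.eq_of_injective hp ⟨h0, h.1⟩ hpo
    · exact absurd (CellAt.eq_of_injective hp h hpz) h1
    · exact absurd (CellAt.eq_of_injective hp h hpl) h2
  refine ⟨q, isPTab_hook_two hn hL hq hqcells ?_ ?_, invG_congr hL ?_, hqo, hql, hqz, hins⟩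
  · intro x y hx hy
    obtain rfl := hx.eq_of_injective hq hqo
    obtain rfl := hy.eq_of_injective hq hql
    exact .inl ⟨ho, by omega⟩
  · rintro x y hx hy hxy (⟨h1, -⟩ | ⟨h1, h2, h3⟩)
    · obtain rfl : y = o := Fin.ext (by omega)
      have := hqo.1
      omega
    · obtain rfl : x = l := Fin.ext (by omega)
      have := hql.2
      omega
  · intro x y hxy hB
    have hxl : x ≠ l := by
      rintro rfl
      omega
    have hyo : y ≠ o := by
      rintro rfl
      omega
    have := hpz.1
    have := hpl.1
    have := hqz.1
    have := hql.1
    have := hpo.1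
    have := hqo.1
    by_cases hyl : y = l
    · subst hyl
      have hxo : x ≠ o := by
        rintro rfl
        exact hB (.inl ⟨ho, by omega⟩)
      have hx0 : x.val ≠ 0 := fun h => hxo (Fin.ext (h.trans ho.symm))
      have hxs : s ≤ x.val := by
        by_contra hlt
        exact hB (.inr ⟨by omega, by omega, hl⟩)
      have hxz : x ≠ z := by
        rintro rfl
        omega
      have hxa : x ≠ a := by
        rintro rfl
        omega
      have h1 := hne x hxz hxl hxo
      have h2 := hqx x hxz hxl
      have h3 : (p x).1.val ≠ 1 := fun h => hxa (CellAt.eq_of_injective hp ⟨h, h1.1⟩ hpa)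
      omega
    · by_cases hxo : x = o
      · subst hxo
        by_cases hyz : y = z
        · subst hyz
          omega
        · have := hqx y hyz hyl
          omega
      · have hxf := hne x
        have hyf := hne y
        have hxq := hqx x
        have hyq := hqx y
        by_cases hxz : x = z
        · subst hxz
          have := hyf hxy.ne' hyl hyo
          have := hyq hxy.ne' hyl
          omega
        · have := hxf hxz hxl hxo
          have := hxq hxz hxl
          by_cases hyz : y = z
          · subst hyz
            omega
          · have := hyf hyz hyl hyo
            have := hyq hyz hyl
            omega

/-- Rows `(a, n), (1, c)` become the row `(a, n)`, followed by `1`, `c`. -/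
lemma exists_move_down (hn : 5 ≤ n) (hrs : r < s) (hs : s ≤ n - 2)
    (hL : ∀ x y : Fin n, ltP n m (x.val + 1) (y.val + 1) ↔ Below n r s x y)
    (hp : Function.Injective p)
    (hcells : ∀ i j, (∃ x, CellAt p x i j) ↔
      (j = 0 ∧ i < n - 2) ∨ (i = 0 ∧ j = 1) ∨ (i = 1 ∧ j = 1))
    {a l o c : Fin n} (ho : o.val = 0) (hpo : CellAt p o 1 0) (ha : a.val < r)
    (ha0 : 1 ≤ a.val) (hpa : CellAt p a 0 0) (hl : l.val = n - 1) (hpl : CellAt p l 0 1)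
    (hc : s ≤ c.val) (hcl : c.val ≠ n - 1) (hpc : CellAt p c 1 1) :
    ∃ q, IsPTab n m (2 :: List.replicate (n - 2) 1) q ∧ invG n m q = invG n m p ∧
      CellAt q o 1 0 ∧ CellAt q l 0 1 ∧ CellAt q c 2 0 ∧ InsertedInColumn c p q := by
  obtain ⟨q, hq, hqcells, hqk, hins⟩ :=
    exists_insertedInColumn hn hp le_rfl (by omega) hcells hpc (k := 2) (by omega) (by omega)
  have hqc : CellAt q c 2 0 := ⟨hqk, hins.1⟩
  have hoc : o ≠ c := by
    rintro rfl
    omega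
  have hlc : l ≠ c := by
    rintro rfl
    omega
  have hac : a ≠ c := by
    rintro rfl
    omega
  have hqo : CellAt q o 1 0 := by
    have := hins.2 o hoc
    have := hpo.1
    have := hpo.2
    exact ⟨by omega, by omega⟩
  have hql : CellAt q l 0 1 := by
    have := hins.2 l hlc
    have := hpl.1
    have := hpl.2
    exact ⟨by omega, by omega⟩
  have hqa : CellAt q a 0 0 := by
    have := hins.2 a hac
    have := hpa.1
    have := hpa.2
    exact ⟨by omega, by omega⟩
  refine ⟨q, isPTab_hook_two hn hL hq hqcells ?_ ?_, invG_congr hL ?_, hqo, hql, hqc, hins⟩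
  · intro x y hx hy
    obtain rfl := hx.eq_of_injective hq hqa
    obtain rfl := hy.eq_of_injective hq hql
    exact .inr ⟨ha0, by omega, hl⟩
  · rintro x y hx hy hxy (⟨h1, h2⟩ | ⟨h1, h2, h3⟩)
    · obtain rfl : y = o := Fin.ext (by omega)
      have := hqo.1
      obtain rfl : x = a := CellAt.eq_of_injective hq ⟨by omega, hx⟩ hqa
      omega
    · obtain rfl : x = l := Fin.ext (by omega)
      have := hql.2
      omega
  · intro x y hxy hB
    have hpc1 := hpc.1
    have below {w : Fin n} (hwa : w ≠ a) (hwl : w ≠ l) (hwo : w ≠ o) (hwc : w ≠ c) :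
        2 ≤ (p w).1.val := by
      have h0 : (p w).2.val = 0 := by
        rcases (hcells _ _).1 ⟨w, rfl, rfl⟩ with h | h | h
        · exact h.1
        · exact absurd (CellAt.eq_of_injective hp h hpl) hwl
        · exact absurd (CellAt.eq_of_injective hp h hpc) hwc
      have h1 : (p w).1.val ≠ 0 := fun h => hwa (CellAt.eq_of_injective hp ⟨h, h0⟩ hpa)
      have h2 : (p w).1.val ≠ 1 := fun h => hwo (CellAt.eq_of_injective hp ⟨h, h0⟩ hpo)
      omega
    have row {w : Fin n} (hwo : w ≠ o) (hwc : w ≠ c) :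
        ((p w).1.val = 0 ∧ (q w).1.val = 0) ∨
          (2 ≤ (p w).1.val ∧ (q w).1.val = (p w).1.val + 1) := by
      have h := hins.2 w hwc
      by_cases hwa : w = a
      · subst hwa
        exact .inl ⟨hpa.1, hqa.1⟩
      · by_cases hwl : w = l
        · subst hwl
          exact .inl ⟨hpl.1, hql.1⟩
        · have := below hwa hwl hwo hwc
          omega
    have hyo : y ≠ o := by
      rintro rfl
      omega
    by_cases hxc : x = c
    · subst hxc
      have := row hyo hxy.ne'
      have := hqc.1
      omega
    · by_cases hyc : y = c
      · subst hyc
        have hxo : x ≠ o := by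
          rintro rfl
          exact hB (.inl ⟨ho, by omega⟩)
        have := row hxo hxc
        have := hqc.1
        omega
      · have := hins.2 x hxc
        have := hins.2 y hyc
        omega

lemma exists_corresponds_of_hook_three (hn : 5 ≤ n) (hr : 2 ≤ r) (hrs : r < s) (hs : s ≤ n - 2)
    (hL : ∀ x y : Fin n, ltP n m (x.val + 1) (y.val + 1) ↔ Below n r s x y)
    (hp : IsPTab n m (3 :: List.replicate (n - 3) 1) p) :
    ∃ q, IsPTab n m (2 :: List.replicate (n - 2) 1) q ∧ invG n m q = invG n m p ∧
      Corresponds n s p q := by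
  obtain ⟨hinj, hcells, hrow, -⟩ := hp
  rw [cells_hook_three hn] at hcells
  obtain ⟨o, hpo⟩ := (hcells 0 0).2 (by omega)
  obtain ⟨z, hpz⟩ := (hcells 0 1).2 (by omega)
  obtain ⟨l, hpl⟩ := (hcells 0 2).2 (by omega)
  have h1 := (hL o z).1 (hrow o z (Fin.ext (hpz.1.trans hpo.1.symm)) (by
    rw [hpz.2, hpo.2]))
  have h2 := (hL z l).1 (hrow z l (Fin.ext (hpl.1.trans hpz.1.symm)) (by
    rw [hpl.2, hpz.2]))
  unfold Below at h1 h2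
  have ho : o.val = 0 := by omega
  have hz : r ≤ z.val ∧ z.val < s := by omega
  have hl : l.val = n - 1 := by omega
  obtain ⟨q, hq, hinv, hqz, hins⟩ := exists_move_last hn hrs hL hinj (by omega) (by omega)
    hcells ho hpo hz.1 hpz hl hpl fun x hx _ hx0 => by
      rw [pos_iff_ne_zero]
      intro h
      obtain rfl := CellAt.eq_of_injective hinj ⟨h, hx0⟩ hpo
      omega
  exact ⟨q, hq, hinv, .inl ⟨z, l, hqz, hz.2, hl, hpl, hins⟩⟩

lemma exists_corresponds_of_two_two (hn : 5 ≤ n) (hr : 2 ≤ r) (hrs : r < s) (hs : s ≤ n - 2)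
    (hL : ∀ x y : Fin n, ltP n m (x.val + 1) (y.val + 1) ↔ Below n r s x y)
    (hp : IsPTab n m (2 :: 2 :: List.replicate (n - 4) 1) p) :
    ∃ q, IsPTab n m (2 :: List.replicate (n - 2) 1) q ∧ invG n m q = invG n m p ∧
      Corresponds n s p q := by
  obtain ⟨hinj, hcells, hrow, hcol⟩ := hp
  rw [cells_two_two hn] at hcells
  obtain ⟨a, ha⟩ := (hcells 0 0).2 (by omega)
  obtain ⟨b, hb⟩ := (hcells 0 1).2 (by omega)
  obtain ⟨c, hc⟩ := (hcells 1 0).2 (by omega)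
  obtain ⟨d, hd⟩ := (hcells 1 1).2 (by omega)
  have h1 := (hL a b).1 (hrow a b (Fin.ext (hb.1.trans ha.1.symm)) (by rw [hb.2, ha.2]))
  have h2 := (hL c d).1 (hrow c d (Fin.ext (hd.1.trans hc.1.symm)) (by rw [hd.2, hc.2]))
  have h3 := (hL c a).not.1 (hcol a c (by rw [hc.1, ha.1]) (Fin.ext (hc.2.trans ha.2.symm)))
  have h4 := (hL d b).not.1 (hcol b d (by rw [hd.1, hb.1]) (Fin.ext (hd.2.trans hb.2.symm)))
  unfold Below at h1 h2 h3 h4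
  have hac : a.val ≠ c.val := fun h => by
    obtain rfl := Fin.ext h
    have := ha.1
    have := hc.1
    omega
  have hbd : b.val ≠ d.val := fun h => by
    obtain rfl := Fin.ext h
    have := hb.1
    have := hd.1
    omega
  by_cases ha0 : a.val = 0
  · have hl : d.val = n - 1 := by omega
    rcases lt_or_ge b.val s with hbs | hbs
    · obtain ⟨q, hq, hinv, hqo, hql, hqz, hins⟩ := exists_swap_last hn hrs hs hL hinj hcells
        ha0 ha (by omega) hbs hb hc (by omega) hl hd
      exact ⟨q, hq, hinv, .inr (.inr (.inl ⟨a, d, b, ha0, hqo, hl, hql, hqz, hd, hins⟩))⟩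
    · obtain ⟨q, hq, hinv, hqz, hins⟩ := exists_move_last hn hrs hL hinj le_rfl (by omega)
        hcells ha0 ha (by omega) hb hl hd fun x hx _ hx0 => by
          have h0 : (p x).1.val ≠ 0 := fun h => by
            obtain rfl := CellAt.eq_of_injective hinj ⟨h, hx0⟩ ha
            omega
          have h1 : (p x).1.val ≠ 1 := fun h => by
            obtain rfl := CellAt.eq_of_injective hinj ⟨h, hx0⟩ hc
            omega
          omega
      exact ⟨q, hq, hinv, .inr (.inl ⟨b, d, hqz, hbs, by omega, hl, hd, hins⟩)⟩
  · have hl : b.val = n - 1 := by omega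
    have ho : c.val = 0 := by omega
    obtain ⟨q, hq, hinv, hqo, hql, hqc, hins⟩ := exists_move_down hn hrs hs hL hinj hcells
      ho hc (by omega) (by omega) ha hl hb (by omega) (by omega) hd
    exact ⟨q, hq, hinv, .inr (.inr (.inr ⟨c, b, d, ho, hqo, hl, hql, hqc, hd, hins⟩))⟩

lemma coeff_Bpoly (lam : List ℕ) (i : ℕ) :
    (Bpoly n m lam).coeff i =
      ((Finset.univ.filter fun p => IsPTab n m lam p ∧ invG n m p = i).card : ℤ) := by
  unfold Bpoly
  rw [Polynomial.finsetSum_coeff, ← Finset.filter_filter, Finset.card_filter]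
  push_cast
  refine Finset.sum_congr rfl fun p _ => ?_
  rw [Polynomial.coeff_X_pow]
  exact if_congr eq_comm rfl rfl

end Tableaux

/-- In the same situation, every coefficient of
`B_{(2,2,1^{n-4})}(t) + B_{(3,1^{n-3})}(t)` is at most the corresponding coefficient of
`B_{(2,1^{n-2})}(t)`. -/
theorem stmt_11 (n r s : ℕ) (hn : 5 ≤ n) (hr : 2 ≤ r) (hrs : r < s) (hs : s ≤ n - 2)
    (m : ℕ → ℕ) (hm1 : m 1 = r)
    (hmmid : ∀ i, 2 ≤ i → i ≤ s → m i = n - 1)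
    (hmtop : ∀ i, s + 1 ≤ i → i ≤ n - 1 → m i = n) :
    ∀ i : ℕ, (Bpoly n m (2 :: 2 :: List.replicate (n - 4) 1)
        + Bpoly n m (3 :: List.replicate (n - 3) 1)).coeff i ≤
      (Bpoly n m (2 :: List.replicate (n - 2) 1)).coeff i := by
  intro i
  have hL := ltP_iff_below (m := m) hrs hs hm1 hmmid hmtop
  rw [Polynomial.coeff_add, coeff_Bpoly, coeff_Bpoly, coeff_Bpoly]
  norm_cast
  rw [← Finset.card_union_of_disjoint]
  · refine Finset.card_le_card_of_forall_subsingleton (Corresponds n s) ?_ ?_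
    · intro p hp
      simp only [Finset.mem_union, Finset.mem_filter, Finset.mem_univ, true_and] at hp
      obtain ⟨q, hq, hinv, hpq⟩ : ∃ q, IsPTab n m (2 :: List.replicate (n - 2) 1) q ∧
          invG n m q = invG n m p ∧ Corresponds n s p q := by
        rcases hp with ⟨hp, -⟩ | ⟨hp, -⟩
        · exact exists_corresponds_of_two_two hn hr hrs hs hL hp
        · exact exists_corresponds_of_hook_three hn hr hrs hs hL hp
      have hi : invG n m p = i := hp.elim And.right And.right
      exact ⟨q, by simpa using ⟨hq, hinv.trans hi⟩, hpq⟩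
    · intro q hq p₁ h₁ p₂ h₂
      have hq : IsPTab n m (2 :: List.replicate (n - 2) 1) q := (Finset.mem_filter.1 hq).2.1
      exact h₁.2.left_unique hs hn hq.1 h₂.2
  · refine Finset.disjoint_filter.2 fun p _ h₁ h₂ => ?_
    have hc₁ := (cells_two_two hn).1 h₁.1.2.1 0 2
    have hc₂ := (cells_hook_three hn).1 h₂.1.2.1 0 2
    rw [hc₁] at hc₂
    omega
end

section
/- Let n, r, s be integers with 1 ≤ s < r ≤ n−1 and let ℓ be an integer with 0 ≤ ℓ ≤ min(n−r, s). Define C_ℓ(t) = t^{(r−s)ℓ} · (∏_{j=n−r−ℓ+1}^{n−r} [j]_t) · (∏_{j=s−ℓ+1}^{s} [j]_t) · (∏_{j=r−s}^{r−ℓ−1} [j]_t) · [n−s−ℓ−1]_t! · [n−2ℓ]_t ∈ ℤ[t] (empty products equal 1), and set E = n(n−1)/2 − (n−r)s. Writing C_ℓ(t) = Σ_i c_i t^i with c_i = 0 for i < 0, one has: c_i = 0 for all i > E; c_i = c_{E−i} for all 0 ≤ i ≤ E; and c_i ≤ c_{i+1} for all integers i with 0 ≤ i and 2(i+1) ≤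 E. -/
/-- The `t`-integer `[k]_t = 1 + t + ⋯ + t^{k-1} ∈ ℤ[t]` (so `[0]_t = 0`). -/
noncomputable def qint (k : ℕ) : Polynomial ℤ :=
  ∑ i ∈ Finset.range k, Polynomial.X ^ i

/-- The `t`-factorial `[k]_t! = ∏_{j=1}^{k} [j]_t` (so `[0]_t! = 1`). -/
noncomputable def qfact (k : ℕ) : Polynomial ℤ :=
  ∏ j ∈ Finset.range k, qint (j + 1)

/-- `f` is palindromic with center of symmetry `E/2` and unimodal: writing
`f = Σ_i c_i t^i`, we have `c_i = 0` for `i > E`, `c_i = c_{E-i}` for `0 ≤ i ≤ E`, and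
`c_i ≤ c_{i+1}` whenever `2(i+1) ≤ E`. -/
def PalindromicUnimodal (E : ℕ) (f : Polynomial ℤ) : Prop :=
  (∀ i : ℕ, E < i → f.coeff i = 0) ∧
  (∀ i : ℕ, i ≤ E → f.coeff i = f.coeff (E - i)) ∧
  (∀ i : ℕ, 2 * (i + 1) ≤ E → f.coeff i ≤ f.coeff (i + 1))

/-- The coefficients of `p`, extended by zero to negative exponents. -/
noncomputable def intCoeff (p : Polynomial ℤ) (x : ℤ) : ℤ :=
  if 0 ≤ x then p.coeff x.toNat else 0

/-- `f` is symmetric about `E / 2` and increases up to there. -/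
structure SymmUnimodal (E : ℤ) (f : ℤ → ℤ) : Prop where
  symm : ∀ x, f (E - x) = f x
  le_succ : ∀ x, 2 * (x + 1) ≤ E → f x ≤ f (x + 1)

theorem intCoeff_natCast (p : Polynomial ℤ) (i : ℕ) : intCoeff p i = p.coeff i := by
  simp [intCoeff]

theorem intCoeff_of_neg (p : Polynomial ℤ) {x : ℤ} (hx : x < 0) : intCoeff p x = 0 := by
  simp [intCoeff, hx]

theorem intCoeff_sum {ι : Type*} (s : Finset ι) (p : ι → Polynomial ℤ) (x : ℤ) :
    intCoeff (∑ i ∈ s, p i) x = ∑ i ∈ s, intCoeff (p i) x := by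
  unfold intCoeff
  split_ifs <;> simp

theorem intCoeff_mul_X_pow (p : Polynomial ℤ) (j : ℕ) (x : ℤ) :
    intCoeff (p * Polynomial.X ^ j) x = intCoeff p (x - j) := by
  unfold intCoeff
  rw [Polynomial.coeff_mul_X_pow']
  split_ifs <;> first | omega | rfl | (congr 1; omega)

theorem intCoeff_mul_qint (p : Polynomial ℤ) (k : ℕ) (x : ℤ) :
    intCoeff (p * qint k) x = ∑ j ∈ Finset.range k, intCoeff p (x - j) := by
  simp only [qint, Finset.mul_sum, intCoeff_sum, intCoeff_mul_X_pow]

namespace SymmUnimodal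

theorem le_of_add_le {E : ℤ} {f : ℤ → ℤ} (hf : SymmUnimodal E f) {a b : ℤ} (hab : a ≤ b)
    (h : a + b ≤ E) : f a ≤ f b := by
  have mono : ∀ c, a ≤ c → 2 * c ≤ E → f a ≤ f c := by
    intro c hc
    induction c, hc using Int.leInduction with
    | base => exact fun _ => le_rfl
    | succ c _ ih => exact fun hE => (ih (by omega)).trans (hf.le_succ c hE)
  by_cases hb : 2 * b ≤ E
  · exact mono b hab hb
  · exact hf.symm b ▸ mono (E - b) (by omega) (by omega)

theorem sum_range {E : ℤ} {f : ℤ → ℤ} (hf : SymmUnimodal E f) (m : ℕ) :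
    SymmUnimodal (E + m) fun x => ∑ j ∈ Finset.range (m + 1), f (x - j) where
  symm x := by
    rw [← Finset.sum_range_reflect]
    refine Finset.sum_congr rfl fun j hj => ?_
    rw [← hf.symm (x - j)]
    have := Finset.mem_range.1 hj
    congr 1
    omega
  le_succ x hx := by
    rw [Finset.sum_range_succ, Finset.sum_range_succ']
    refine add_le_add (Finset.sum_le_sum fun j _ => le_of_eq (congrArg f ?_))
      (hf.le_of_add_le ?_ ?_) <;> push_cast <;> omega

theorem mul_qint {E : ℤ} {p : Polynomial ℤ} (hp : SymmUnimodal E (intCoeff p)) {k : ℕ}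
    (hk : 1 ≤ k) : SymmUnimodal (E + (k - 1)) (intCoeff (p * qint k)) := by
  obtain ⟨m, rfl⟩ := Nat.exists_eq_add_of_le' hk
  rw [funext (intCoeff_mul_qint p (m + 1))]
  simpa using hp.sum_range m

theorem mul_prod_qint {ι : Type*} {E : ℤ} {p : Polynomial ℤ}
    (hp : SymmUnimodal E (intCoeff p)) (s : Finset ι) (k : ι → ℕ) (hk : ∀ j ∈ s, 1 ≤ k j) :
    SymmUnimodal (E + ∑ j ∈ s, ((k j : ℤ) - 1)) (intCoeff (p * ∏ j ∈ s, qint (k j))) := by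
  classical
  induction s using Finset.induction_on with
  | empty => simpa using hp
  | insert a s ha ih =>
    have h := (ih fun j hj => hk j (Finset.mem_insert_of_mem hj)).mul_qint
      (hk a (Finset.mem_insert_self a s))
    rw [Finset.sum_insert ha, Finset.prod_insert ha]
    convert h using 1
    · ring
    · congr 1
      ring

theorem X_pow (m : ℕ) : SymmUnimodal (2 * m) (intCoeff (Polynomial.X ^ m)) where
  symm x := by
    simp only [intCoeff, Polynomial.coeff_X_pow]
    split_ifs <;> omega
  le_succ x hx := by
    simp only [intCoeff, Polynomial.coeff_X_pow]
    split_ifs <;> omega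

theorem palindromicUnimodal {E : ℕ} {p : Polynomial ℤ} (hp : SymmUnimodal E (intCoeff p)) :
    PalindromicUnimodal E p := by
  refine ⟨fun i hi => ?_, fun i hi => ?_, fun i hi => ?_⟩
  · rw [← intCoeff_natCast, ← hp.symm, intCoeff_of_neg]
    omega
  · rw [← intCoeff_natCast, ← intCoeff_natCast, ← hp.symm, Nat.cast_sub hi]
  · have h := hp.le_succ i (by exact_mod_cast hi)
    rwa [← Nat.cast_succ, intCoeff_natCast, intCoeff_natCast] at h

end SymmUnimodal

theorem two_mul_sum_Ico_sub_one (a m : ℕ) :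
    2 * ∑ j ∈ Finset.Ico a (a + m), ((j : ℤ) - 1) = m * (2 * a + m - 3) := by
  induction m with
  | zero => simp
  | succ m ih =>
    rw [← add_assoc, Finset.sum_Ico_succ_top (by omega), mul_add, ih]
    push_cast
    ring

theorem two_mul_sum_range (m : ℕ) :
    2 * ∑ j ∈ Finset.range m, (((j + 1 : ℕ) : ℤ) - 1) = m * (m - 1) := by
  induction m with
  | zero => simp
  | succ m ih =>
    rw [Finset.sum_range_succ, mul_add, ih]
    push_cast
    ring

theorem two_mul_center (a d s : ℕ) (hd : 1 ≤ d) :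
    2 * (((a + d + s) * (a + d + s - 1) / 2 - a * s : ℕ) : ℤ) =
      (a + d + s) * (a + d + s - 1) - 2 * (a * s) := by
  obtain ⟨e, rfl⟩ := Nat.exists_eq_add_of_le' hd
  have hpred : a + (e + 1) + s - 1 = a + e + s := by omega
  have hdvd : 2 * ((a + (e + 1) + s) * (a + e + s) / 2) = (a + (e + 1) + s) * (a + e + s) := by
    refine Nat.mul_div_cancel' ?_
    have h := (Nat.even_mul_succ_self (a + e + s)).two_dvd
    rwa [mul_comm, show a + e + s + 1 = a + (e + 1) + s by ring] at h
  have hle : a * s ≤ (a + (e + 1) + s) * (a + e + s) / 2 := by nlinarith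
  rw [hpred, Nat.cast_sub hle, mul_sub]
  have := congrArg (Nat.cast : ℕ → ℤ) hdvd
  push_cast at this ⊢
  rw [this]
  ring

/-- For `1 ≤ s < r ≤ n-1` and `0 ≤ ℓ ≤ min(n-r, s)`, the polynomial
`C_ℓ(t) = t^{(r-s)ℓ} (∏_{j=n-r-ℓ+1}^{n-r} [j]_t)(∏_{j=s-ℓ+1}^{s} [j]_t)
(∏_{j=r-s}^{r-ℓ-1} [j]_t) [n-s-ℓ-1]_t! [n-2ℓ]_t` is palindromic with center of
symmetry `E/2` and unimodal, where `E = n(n-1)/2 - (n-r)s`. -/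
theorem stmt_18 (n r s ℓ : ℕ) (hs1 : 1 ≤ s) (hsr : s < r) (hr : r ≤ n - 1)
    (hl : ℓ ≤ min (n - r) s) :
    PalindromicUnimodal (n * (n - 1) / 2 - (n - r) * s)
      (Polynomial.X ^ ((r - s) * ℓ) *
        (∏ j ∈ Finset.Icc (n - r - ℓ + 1) (n - r), qint j) *
        (∏ j ∈ Finset.Icc (s - ℓ + 1) s, qint j) *
        (∏ j ∈ Finset.Icc (r - s) (r - ℓ - 1), qint j) *
        qfact (n - s - ℓ - 1) * qint (n - 2 * ℓ)) := by
  obtain ⟨hla, hls⟩ := le_min_iff.1 hl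
  obtain ⟨b, hb⟩ := Nat.exists_eq_add_of_le' hla
  obtain ⟨u, rfl⟩ := Nat.exists_eq_add_of_le' hls
  obtain ⟨e, rfl⟩ := Nat.exists_eq_add_of_lt hsr
  obtain rfl : n = b + ℓ + (e + 1) + (u + ℓ) := by omega
  have e₁ : Finset.Icc (b + ℓ - ℓ + 1) (b + ℓ) = Finset.Ico (b + 1) (b + 1 + ℓ) := by
    ext; simp; omega
  have e₂ : Finset.Icc (u + ℓ - ℓ + 1) (u + ℓ) = Finset.Ico (u + 1) (u + 1 + ℓ) := by
    ext; simp; omega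
  have e₃ : Finset.Icc (u + ℓ + e + 1 - (u + ℓ)) (u + ℓ + e + 1 - ℓ - 1) =
      Finset.Ico (e + 1) (e + 1 + u) := by
    ext; simp; omega
  have hd : u + ℓ + e + 1 - (u + ℓ) = e + 1 := by omega
  have hm : b + ℓ + (e + 1) + (u + ℓ) - (u + ℓ) - ℓ - 1 = b + e := by omega
  have hk : b + ℓ + (e + 1) + (u + ℓ) - 2 * ℓ = b + e + u + 1 := by omega
  rw [hb, e₁, e₂, e₃, hd, hm, hk, qfact]
  have pos : ∀ a m : ℕ, ∀ j ∈ Finset.Ico (a + 1) m, 1 ≤ j := fun a m j hj =>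
    (Nat.le_add_left 1 a).trans (Finset.mem_Ico.1 hj).1
  have h := (((((SymmUnimodal.X_pow ((e + 1) * ℓ)).mul_prod_qint _ _ (pos b (b + 1 + ℓ))
    ).mul_prod_qint _ _ (pos u (u + 1 + ℓ))).mul_prod_qint _ _ (pos e (e + 1 + u))
    ).mul_prod_qint (Finset.range (b + e)) (fun j => j + 1) (fun j _ => Nat.le_add_left 1 j)
    ).mul_qint (Nat.le_add_left 1 (b + e + u))
  refine SymmUnimodal.palindromicUnimodal ?_
  convert h using 1
  have h₀ := two_mul_center (b + ℓ) (e + 1) (u + ℓ) (Nat.le_add_left 1 e)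
  have h₁ := two_mul_sum_Ico_sub_one (b + 1) ℓ
  have h₂ := two_mul_sum_Ico_sub_one (u + 1) ℓ
  have h₃ := two_mul_sum_Ico_sub_one (e + 1) u
  have h₄ := two_mul_sum_range (b + e)
  refine mul_left_cancel₀ (two_ne_zero (α := ℤ)) ?_
  rw [h₀]
  simp only [mul_add, h₁, h₂, h₃, h₄]
  push_cast
  ring
end

section
/- Let n, r, s be integers with 2 ≤ s ≤ r ≤ n−2, and set E = (n−1)(n−2)/2 + r − s. Define F_1(t) = [n−4]_t! [n]_t [n−3]_t [r−1]_t [n−s−1]_t, F_2(t) = [n−4]_t! [n−2]_t ( t^{n−s−1}[n−3]_t + t^{n−s}[r−2]_t[s−1]_t + t^{r−1}[n−r−1]_t[n−s−2]_t ), and F_3(t) = [n−4]_t! t^{n+r−s−3} [2]_t [n−r−1]_t [s−1]_t. Then each of F_1, F_2, F_3, written as Σ_i c_i t^i with c_i = 0 for i < 0, satisfies: c_i = 0 for all i > E; c_i = c_{E−i} for all 0 ≤ i ≤ E; and c_i ≤ c_{i+1} for all integers i with 0 ≤ i and 2(i+1) ≤ E. -/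
/-- The coefficients of `f`, extended by zero to integer exponents. -/
def zcoeff (f : Polynomial ℤ) (i : ℤ) : ℤ := if 0 ≤ i then f.coeff i.toNat else 0

/-- `f` is palindromic with center `E/2` and its coefficients weakly increase up to the center,
for an integer `E` and coefficients indexed by `ℤ`. -/
def ZPalindromicUnimodal (E : ℤ) (f : Polynomial ℤ) : Prop :=
  (∀ i, zcoeff f (E - i) = zcoeff f i) ∧
  (∀ i, 2 * (i + 1) ≤ E + 1 → zcoeff f i ≤ zcoeff f (i + 1))

section

open Polynomial

lemma qint_succ (k : ℕ) : qint (k + 1) = qint k + X ^ k := Finset.sum_range_succ _ _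

lemma qint_mul_X_sub_one (k : ℕ) : qint k * (X - 1) = X ^ k - 1 := geom_sum_mul X k

lemma zcoeff_natCast (f : ℤ[X]) (i : ℕ) : zcoeff f i = f.coeff i := by
  simp [zcoeff]

lemma zcoeff_of_neg (f : ℤ[X]) {i : ℤ} (hi : i < 0) : zcoeff f i = 0 :=
  if_neg (not_le.mpr hi)

lemma zcoeff_add (f g : ℤ[X]) (i : ℤ) : zcoeff (f + g) i = zcoeff f i + zcoeff g i := by
  unfold zcoeff; split_ifs <;> simp

lemma zcoeff_mul_X_pow (f : ℤ[X]) (k : ℕ) (i : ℤ) :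
    zcoeff (f * X ^ k) i = zcoeff f (i - k) := by
  unfold zcoeff
  rw [coeff_mul_X_pow']
  by_cases h : (k : ℤ) ≤ i
  · rw [if_pos (by omega), if_pos (by omega), if_pos (by omega)]
    congr 1
    omega
  · rw [if_neg (by omega : ¬ 0 ≤ i - (k : ℤ))]
    split_ifs <;> first | rfl | omega

lemma zcoeff_mul_qint (f : ℤ[X]) (k : ℕ) (i : ℤ) :
    zcoeff (f * qint k) i = ∑ j ∈ Finset.range k, zcoeff f (i - j) := by
  induction k with
  | zero => simp [qint, zcoeff]
  | succ k ih => rw [qint_succ, mul_add, zcoeff_add, ih, zcoeff_mul_X_pow, Finset.sum_range_succ]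

lemma zcoeff_one (i : ℤ) : zcoeff 1 i = if i = 0 then 1 else 0 := by
  unfold zcoeff
  rw [coeff_one]
  split_ifs <;> omega

lemma zcoeff_qint (k : ℕ) (i : ℤ) : zcoeff (qint k) i = if 0 ≤ i ∧ i < k then 1 else 0 := by
  induction k with
  | zero => simp [qint, zcoeff]
  | succ k ih =>
    rw [qint_succ, zcoeff_add, ih, ← one_mul (X ^ k), zcoeff_mul_X_pow, zcoeff_one]
    push_cast
    split_ifs <;> omega

namespace ZPalindromicUnimodal

variable {E : ℤ} {f : ℤ[X]}

lemma monotone (hf : ZPalindromicUnimodal E f) {a b : ℤ} (hab : a ≤ b) (hb : 2 * b ≤ E + 1) :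
    zcoeff f a ≤ zcoeff f b := by
  induction b, hab using Int.leInduction with
  | base => exact le_rfl
  | succ b _ ih => exact (ih (by omega)).trans (hf.2 b hb)

lemma one : ZPalindromicUnimodal 0 1 := by
  refine ⟨fun i => ?_, fun i hi => ?_⟩ <;> simp only [zcoeff_one] <;> split_ifs <;> omega

lemma mul_X_pow (hf : ZPalindromicUnimodal E f) (k : ℕ) :
    ZPalindromicUnimodal (E + 2 * k) (f * X ^ k) := by
  refine ⟨fun i => ?_, fun i hi => ?_⟩ <;> simp only [zcoeff_mul_X_pow]
  · rw [← hf.1 (i - k)]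
    congr 1
    ring
  · exact hf.monotone (by omega) (by omega)

lemma mul_qint (hf : ZPalindromicUnimodal E f) (k : ℕ) :
    ZPalindromicUnimodal (E + k - 1) (f * qint k) := by
  refine ⟨fun i => ?_, fun i hi => ?_⟩ <;> simp only [zcoeff_mul_qint]
  · rw [← Finset.sum_range_reflect]
    refine Finset.sum_congr rfl fun j hj => ?_
    rw [Finset.mem_range] at hj
    rw [← hf.1 (i - j)]
    congr 1
    omega
  · have hsum : ∑ j ∈ Finset.range k, zcoeff f (i + 1 - j) -
        ∑ j ∈ Finset.range k, zcoeff f (i - j) = zcoeff f (i + 1) - zcoeff f (i + 1 - k) := by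
      rw [← Finset.sum_sub_distrib]
      have := Finset.sum_range_sub' (fun j : ℕ => zcoeff f (i + 1 - j)) k
      simpa [add_sub_add_right_eq_sub] using this
    have hle : zcoeff f (i + 1 - k) ≤ zcoeff f (i + 1) := by
      by_cases h : 2 * (i + 1) ≤ E + 1
      · exact hf.monotone (by omega) h
      · rw [← hf.1 (i + 1)]
        exact hf.monotone (by omega) (by omega)
    linarith

lemma mul_qfact (hf : ZPalindromicUnimodal E f) (k : ℕ) :
    ZPalindromicUnimodal (E + k.choose 2) (f * qfact k) := by
  induction k with
  | zero => simpa [qfact] using hf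
  | succ k ih =>
    have h := ih.mul_qint (k + 1)
    rw [mul_assoc] at h
    rw [qfact, Finset.prod_range_succ, ← qfact, Nat.choose_succ_succ', Nat.choose_one_right]
    convert h using 1
    push_cast
    ring

lemma palindromicUnimodal {D : ℕ} (hf : ZPalindromicUnimodal D f) : PalindromicUnimodal D f := by
  refine ⟨fun i hi => ?_, fun i hi => ?_, fun i hi => ?_⟩
  · rw [← zcoeff_natCast, ← hf.1, zcoeff_of_neg _ (by omega)]
  · rw [← zcoeff_natCast, ← zcoeff_natCast, ← hf.1, Nat.cast_sub hi]
  · simpa only [← zcoeff_natCast, Nat.cast_succ] using hf.2 i (by omega)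

end ZPalindromicUnimodal

lemma qint_mul_reflection_identity (q d u : ℕ) :
    qint (q + d + u + 1) * X ^ (d + u + 1) + qint (q + d) * qint (q + 1) * X ^ (d + u + 2) +
        qint (u + 1) * qint (d + u) * X ^ (q + d + 1) =
      qint (q + d + u + 1) * X ^ (q + d + 1) + qint (q + d) * qint (q + 1) * X ^ (d + u + 1) +
        qint (u + 1) * qint (d + u) * X ^ (q + d + 2) := by
  have hX : (X - 1 : ℤ[X]) ≠ 0 := by simpa using X_sub_C_ne_zero (1 : ℤ)
  refine mul_right_cancel₀ hX ?_
  have h₁ := qint_mul_X_sub_one (q + d + u + 1)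
  have h₂ := qint_mul_X_sub_one (q + d)
  have h₃ := qint_mul_X_sub_one (q + 1)
  have h₄ := qint_mul_X_sub_one (u + 1)
  have h₅ := qint_mul_X_sub_one (d + u)
  have h₂₃ := congr_arg₂ (· * ·) h₂ h₃
  have h₄₅ := congr_arg₂ (· * ·) h₄ h₅
  linear_combination (X ^ (d + u + 1) - X ^ (q + d + 1)) * h₁ + X ^ (d + u + 1) * h₂₃ -
    X ^ (q + d + 1) * h₄₅

lemma zPalindromicUnimodal_qint_sum (q d u : ℕ) :
    ZPalindromicUnimodal (2 * (q + d + u) + 2 + d)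
      (qint (q + d + u + 1) * X ^ (d + u + 1) + qint (q + d) * qint (q + 1) * X ^ (d + u + 2) +
        qint (u + 1) * qint (d + u) * X ^ (q + d + 1)) := by
  have hA := ZPalindromicUnimodal.one.mul_qint (q + d + u + 1)
  have hB := (ZPalindromicUnimodal.one.mul_qint (q + d)).mul_qint (q + 1)
  have hC := (ZPalindromicUnimodal.one.mul_qint (u + 1)).mul_qint (d + u)
  rw [one_mul] at hA hB hC
  have hsymm : ∀ i, zcoeff (qint (q + d + u + 1) * X ^ (d + u + 1) +
      qint (q + d) * qint (q + 1) * X ^ (d + u + 2) +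
        qint (u + 1) * qint (d + u) * X ^ (q + d + 1)) (2 * (q + d + u) + 2 + d - i) =
      zcoeff (qint (q + d + u + 1) * X ^ (d + u + 1) +
      qint (q + d) * qint (q + 1) * X ^ (d + u + 2) +
        qint (u + 1) * qint (d + u) * X ^ (q + d + 1)) i := by
    intro i
    conv_rhs => rw [qint_mul_reflection_identity]
    simp only [zcoeff_add, zcoeff_mul_X_pow]
    rw [← hA.1 (i - _), ← hB.1 (i - _), ← hC.1 (i - _)]
    push_cast
    congr 1
    · congr 1 <;> congr 1 <;> ring
    · congr 1; ring
  refine ⟨hsymm, fun i hi => ?_⟩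
  rcases hi.eq_or_lt with h | h
  · rw [← hsymm i, show (2 * (q + d + u) + 2 + d - i : ℤ) = i + 1 by omega]
  simp only [zcoeff_add]
  refine add_le_add (add_le_add ?_ ?_) ?_
  · simp only [zcoeff_mul_X_pow, zcoeff_qint]
    push_cast
    split_ifs <;> omega
  · exact (hB.mul_X_pow (d + u + 2)).2 i (by push_cast; omega)
  · exact (hC.mul_X_pow (q + d + 1)).2 i (by push_cast; omega)

end

/-- For `2 ≤ s ≤ r ≤ n-2` and `E = (n-1)(n-2)/2 + r - s`, each of
`F₁ = [n-4]_t! [n]_t [n-3]_t [r-1]_t [n-s-1]_t`,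
`F₂ = [n-4]_t! [n-2]_t (t^{n-s-1}[n-3]_t + t^{n-s}[r-2]_t[s-1]_t
  + t^{r-1}[n-r-1]_t[n-s-2]_t)`, and
`F₃ = [n-4]_t! t^{n+r-s-3} [2]_t [n-r-1]_t [s-1]_t`
is palindromic with center of symmetry `E/2` and unimodal. -/
theorem stmt_19 (n r s : ℕ) (hs : 2 ≤ s) (hsr : s ≤ r) (hr : r ≤ n - 2) :
    PalindromicUnimodal ((n - 1) * (n - 2) / 2 + r - s)
      (qfact (n - 4) * (qint n * qint (n - 3) * qint (r - 1) * qint (n - s - 1))) ∧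
    PalindromicUnimodal ((n - 1) * (n - 2) / 2 + r - s)
      (qfact (n - 4) * (qint (n - 2) *
        (Polynomial.X ^ (n - s - 1) * qint (n - 3) +
         Polynomial.X ^ (n - s) * qint (r - 2) * qint (s - 1) +
         Polynomial.X ^ (r - 1) * qint (n - r - 1) * qint (n - s - 2)))) ∧
    PalindromicUnimodal ((n - 1) * (n - 2) / 2 + r - s)
      (qfact (n - 4) * (Polynomial.X ^ (n + r - s - 3) * qint 2 *
        qint (n - r - 1) * qint (s - 1))) := by
  obtain ⟨q, rfl⟩ := Nat.exists_eq_add_of_le hs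
  obtain ⟨d, rfl⟩ := Nat.exists_eq_add_of_le hsr
  obtain ⟨u, rfl⟩ := Nat.exists_eq_add_of_le (show 2 + q + d + 2 ≤ n by omega)
  have hE : (2 + q + d + 2 + u - 1) * (2 + q + d + 2 + u - 2) / 2 + (2 + q + d) - (2 + q) =
      (q + d + u).choose 2 + 3 * (q + d + u) + 3 + d := by
    have h : (q + d + u + 3).choose 2 = (q + d + u).choose 2 + 3 * (q + d + u) + 3 := by
      simp only [Nat.choose_succ_succ' _ 1, Nat.choose_one_right]
      ring
    rw [Nat.choose_two_right] at h
    rw [show 2 + q + d + 2 + u - 1 = q + d + u + 3 by omega,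
      show 2 + q + d + 2 + u - 2 = q + d + u + 3 - 1 by omega, h]
    omega
  rw [hE, show 2 + q + d + 2 + u - 4 = q + d + u by omega,
    show 2 + q + d + 2 + u - 3 = q + d + u + 1 by omega,
    show 2 + q + d + 2 + u - 2 = q + d + u + 2 by omega,
    show 2 + q + d + 2 + u - (2 + q) - 1 = d + u + 1 by omega,
    show 2 + q + d + 2 + u - (2 + q) - 2 = d + u by omega,
    show 2 + q + d + 2 + u - (2 + q) = d + u + 2 by omega,
    show 2 + q + d + 2 + u - (2 + q + d) - 1 = u + 1 by omega,
    show 2 + q + d + 2 + u + (2 + q + d) - (2 + q) - 3 = q + 2 * d + u + 1 by omega,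
    show 2 + q + d - 1 = q + d + 1 by omega, show 2 + q + d - 2 = q + d by omega,
    show 2 + q - 1 = q + 1 by omega]
  refine ⟨?_, ?_, ?_⟩ <;> apply ZPalindromicUnimodal.palindromicUnimodal
  · have h := ((((ZPalindromicUnimodal.one.mul_qint (2 + q + d + 2 + u)).mul_qint
      (q + d + u + 1)).mul_qint (q + d + 1)).mul_qint (d + u + 1)).mul_qfact (q + d + u)
    convert h using 1
    · push_cast; ring
    · ring
  · have h := ((zPalindromicUnimodal_qint_sum q d u).mul_qint (q + d + u + 2)).mul_qfact
      (q + d + u)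
    convert h using 1
    · push_cast; ring
    · ring
  · have h := ((((ZPalindromicUnimodal.one.mul_X_pow (q + 2 * d + u + 1)).mul_qint 2).mul_qint
      (u + 1)).mul_qint (q + 1)).mul_qfact (q + d + u)
    convert h using 1
    · push_cast; ring
    · ring
end
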